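/- arXiv:2407.13848 — 3 statements merged into one kernel-verified Lean document; each statement's English description precedes it below -/
import Mathlib

section
/- Let p be prime and let n ≥ 2. There exists a field extension L of ℚ_p with [L : ℚ_p] = n such that the only intermediate fields of L/ℚ_p are ℚ_p and L themselves, if and only if n is either prime or a power of p (i.e., n is prime ∨ ∃ k, n = p^k). -/
open Polynomial IntermediateField Filter Topology

section aux

variable {p : ℕ} [hp : Fact p.Prime]

/-- Norms of elements algebraic over `ℚ_p` are discrete. -/
lemma aux_norm_pow {L : Type*} [NormedField L] [NormedAlgebra ℚ_[p] L]
    [Algebra.IsAlgebraic ℚ_[p] L] (x : L) (hx : x ≠ 0) :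
    ∃ z : ℤ, ‖x‖ ^ (minpoly ℚ_[p] x).natDegree = (p : ℝ) ^ z := by
  have hint : IsIntegral ℚ_[p] x := (Algebra.IsAlgebraic.isAlgebraic x).isIntegral
  have h0 : (minpoly ℚ_[p] x).coeff 0 ≠ 0 := minpoly.coeff_zero_ne_zero hint hx
  refine ⟨_, Eq.trans ?_ (Padic.norm_eq_zpow_neg_valuation h0)⟩
  have hd : (minpoly ℚ_[p] x).natDegree ≠ 0 := (minpoly.natDegree_pos hint).ne'
  rw [NormedAlgebra.norm_eq_spectralNorm ℚ_[p] x,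
    spectralNorm.spectralNorm_eq_norm_coeff_zero_rpow, one_div,
    Real.rpow_inv_natCast_pow (norm_nonneg _) hd]

lemma aux_norm_pow_dvd {L : Type*} [NormedField L] [NormedAlgebra ℚ_[p] L]
    [Algebra.IsAlgebraic ℚ_[p] L] (x : L) (hx : x ≠ 0) (n : ℕ)
    (hn : (minpoly ℚ_[p] x).natDegree ∣ n) :
    ∃ z : ℤ, ‖x‖ ^ n = (p : ℝ) ^ z := by
  obtain ⟨z, hz⟩ := aux_norm_pow (p := p) x hx
  obtain ⟨c, rfl⟩ := hn
  refine ⟨z * c, ?_⟩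
  rw [pow_mul, hz, zpow_mul, zpow_natCast]

lemma aux_one_lt : (1 : ℝ) < p := by exact_mod_cast hp.out.one_lt

lemma aux_zpow_inj {a b : ℤ} (h : (p : ℝ) ^ a = (p : ℝ) ^ b) : a = b :=
  zpow_right_injective₀ (by linarith [aux_one_lt (p := p)]) (aux_one_lt (p := p)).ne' h

lemma aux_deg_dvd {L : Type*} [NormedField L] [NormedAlgebra ℚ_[p] L]
    [Algebra.IsAlgebraic ℚ_[p] L] (x : L) (m : ℕ) (hx : ‖x‖ ^ m = (p : ℝ)⁻¹) (hm : 0 < m) :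
    m ∣ (minpoly ℚ_[p] x).natDegree := by
  have h0 : x ≠ 0 := by
    rintro rfl
    rw [norm_zero, zero_pow hm.ne'] at hx
    have := aux_one_lt (p := p)
    have : (0:ℝ) < (p:ℝ)⁻¹ := by positivity
    linarith
  obtain ⟨z, hz⟩ := aux_norm_pow (p := p) x h0
  set D := (minpoly ℚ_[p] x).natDegree
  have h1 : (p : ℝ) ^ (-(D : ℤ)) = (p : ℝ) ^ (z * m) := by
    rw [zpow_neg, zpow_natCast, zpow_mul, ← hz, zpow_natCast, ← inv_pow, ← hx, ← pow_mul, ← pow_mul,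
      mul_comm]
  have h2 := aux_zpow_inj h1
  have : (m : ℤ) ∣ (D : ℤ) := ⟨-z, by linarith⟩
  exact_mod_cast this

lemma aux_norm_p {L : Type*} [NormedField L] [NormedAlgebra ℚ_[p] L] :
    ‖(p : L)‖ = (p : ℝ)⁻¹ := by
  rw [← map_natCast (algebraMap ℚ_[p] L), norm_algebraMap', Padic.norm_p]

lemma aux_inv_lt : (p : ℝ)⁻¹ < 1 := inv_lt_one_of_one_lt₀ aux_one_lt

lemma aux_inv_pos : 0 < (p : ℝ)⁻¹ := by
  have := aux_one_lt (p := p)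
  positivity

lemma aux_binom {L : Type*} [NormedField L] [NormedAlgebra ℚ_[p] L] (x y : L)
    (hx : ‖x‖ ≤ 1) (hy : ‖y‖ ≤ 1) (k : ℕ) :
    ‖(x + y) ^ (p ^ k) - x ^ (p ^ k) - y ^ (p ^ k)‖ ≤ (p : ℝ)⁻¹ * (‖x‖ * ‖y‖) := by
  have : IsUltrametricDist L := IsUltrametricDist.of_normedAlgebra ℚ_[p]
  rw [add_pow_prime_pow_eq hp.out, add_sub_right_comm, add_sub_cancel_left, add_sub_cancel_left,
    norm_mul, norm_mul, norm_mul, aux_norm_p (p := p), mul_assoc, mul_assoc]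
  refine mul_le_mul_of_nonneg_left ?_ aux_inv_pos.le
  rw [← mul_assoc]
  refine mul_le_of_le_one_right (by positivity) ?_
  refine IsUltrametricDist.norm_sum_le_of_forall_le_of_nonneg zero_le_one ?_
  intro i hi
  rw [norm_mul, norm_mul, norm_pow, norm_pow]
  have h1 : ‖x‖ ^ (i - 1) ≤ 1 := pow_le_one₀ (norm_nonneg _) hx
  have h2 : ‖y‖ ^ (p ^ k - i - 1) ≤ 1 := pow_le_one₀ (norm_nonneg _) hy
  have h3 := IsUltrametricDist.norm_natCast_le_one L ((p ^ k).choose i / p)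
  calc _ ≤ (1 : ℝ) * 1 * 1 := by gcongr
    _ = _ := by norm_num

lemma aux_tendsto {L : Type*} [NormedField L] [NormedAlgebra ℚ_[p] L] (u : L)
    (hu : ‖u - 1‖ < 1) : Tendsto (fun j : ℕ => u ^ (p ^ j)) atTop (𝓝 1) := by
  have : IsUltrametricDist L := IsUltrametricDist.of_normedAlgebra ℚ_[p]
  set r := max ‖u - 1‖ (p : ℝ)⁻¹ with hr
  have hr1 : r < 1 := max_lt hu aux_inv_lt
  have hr0 : 0 ≤ r := le_max_of_le_left (norm_nonneg _)
  have key : ∀ j : ℕ, ‖u ^ (p ^ j) - 1‖ ≤ r ^ (j + 1) := by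
    intro j
    induction j with
    | zero => simp [hr]
    | succ j ih =>
      set t := u ^ (p ^ j) - 1 with ht
      have hrle : r ^ (j + 1) ≤ 1 := pow_le_one₀ hr0 hr1.le
      have htr : ‖t‖ ≤ r := ih.trans (pow_le_of_le_one hr0 hr1.le (by omega))
      have h := aux_binom (p := p) 1 t (by simp) (ih.trans hrle) 1
      have e1 : u ^ (p ^ (j + 1)) - 1 = ((1 + t) ^ (p ^ 1) - 1 ^ (p ^ 1) - t ^ (p ^ 1)) + t ^ p := by
        rw [ht]; simp only [one_pow, pow_succ, pow_mul]; ring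
      rw [e1]
      refine (IsUltrametricDist.norm_add_le_max _ _).trans (max_le ?_ ?_)
      · refine h.trans ?_
        rw [norm_one, one_mul, pow_succ r (j+1), mul_comm]
        exact mul_le_mul ih (le_max_right _ _) aux_inv_pos.le (by positivity)
      · rw [norm_pow]
        calc ‖t‖ ^ p ≤ ‖t‖ ^ 2 :=
              pow_le_pow_of_le_one (norm_nonneg _) (ih.trans hrle) hp.out.two_le
          _ = ‖t‖ * ‖t‖ := sq _
          _ ≤ r ^ (j + 1) * r := mul_le_mul ih htr (norm_nonneg _) (by positivity)
          _ = _ := (pow_succ _ _).symm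
  rw [tendsto_iff_norm_sub_tendsto_zero]
  refine squeeze_zero (fun _ => norm_nonneg _) key ?_
  exact (tendsto_pow_atTop_nhds_zero_of_lt_one hr0 hr1).comp (tendsto_add_atTop_nat 1)

lemma aux_norm_one {L : Type*} [NormedField L] [IsUltrametricDist L] (x y : L)
    (h : ‖x - y‖ < ‖y‖) : ‖x‖ = ‖y‖ := by
  have := IsUltrametricDist.norm_add_eq_max_of_norm_ne_norm h.ne
  rw [sub_add_cancel, max_eq_right h.le] at this
  exact this

lemma aux_pow_sub_one {L : Type*} [NormedField L] [IsUltrametricDist L] (x : L)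
    (h : ‖x - 1‖ < 1) (n : ℕ) : ‖x ^ n - 1‖ < 1 := by
  have h1 : ‖x‖ = 1 := by simpa using aux_norm_one x 1 (by simpa using h)
  induction n with
  | zero => simp
  | succ n ih =>
    have : x ^ (n + 1) - 1 = x ^ n * (x - 1) + (x ^ n - 1) := by ring
    rw [this]
    refine (IsUltrametricDist.norm_add_le_max _ _).trans_lt (max_lt ?_ ih)
    simpa [h1] using h

lemma aux_inv_sub_one {L : Type*} [NormedField L] [IsUltrametricDist L] (x : L)
    (h : ‖x - 1‖ < 1) : ‖x⁻¹ - 1‖ < 1 := by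
  have h1 : ‖x‖ = 1 := by simpa using aux_norm_one x 1 (by simpa using h)
  have h0 : x ≠ 0 := by rintro rfl; simp at h1
  have : x⁻¹ - 1 = - (x⁻¹ * (x - 1)) := by field_simp; ring
  rw [this, norm_neg, norm_mul, norm_inv, h1]
  simpa using h

lemma aux_root {L : Type*} [NormedField L] [NormedAlgebra ℚ_[p] L] [FiniteDimensional ℚ_[p] L]
    (u : L) (hu : ‖u - 1‖ < 1) (m : ℕ) (hm : ¬ p ∣ m) : ∃ v : L, ‖v - 1‖ < 1 ∧ v ^ m = u := by
  have : IsUltrametricDist L := IsUltrametricDist.of_normedAlgebra ℚ_[p]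
  have : ProperSpace L := FiniteDimensional.proper ℚ_[p] L
  have hcop : Nat.Coprime p m := (Nat.Prime.coprime_iff_not_dvd hp.out).2 hm
  have h1 : ‖u‖ = 1 := by simpa using aux_norm_one u 1 (by simpa using hu)
  have h0 : u ≠ 0 := by rintro rfl; simp at h1
  have hm0 : m ≠ 0 := by rintro rfl; simp at hm
  set r := ‖u - 1‖
  -- the compact set of units
  have hclosed : IsCompact {v : L | ‖v - 1‖ < 1} := by
    have : {v : L | ‖v - 1‖ < 1} = Metric.ball 1 1 := by ext; simp [dist_eq_norm]
    rw [this]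
    exact Metric.isCompact_of_isClosed_isBounded (IsUltrametricDist.isClosed_ball 1 1)
      Metric.isBounded_ball
  have himg := (hclosed.image (continuous_pow m)).isClosed
  have hlim : Tendsto (fun j : ℕ => u * (u ^ (p ^ (m.totient * j)))⁻¹) atTop (𝓝 u) := by
    have ht : Tendsto (fun j : ℕ => u ^ (p ^ (m.totient * j))) atTop (𝓝 1) :=
      (aux_tendsto u hu).comp
        (tendsto_id.const_mul_atTop' (Nat.totient_pos.2 (Nat.pos_of_ne_zero hm0)))
    simpa using tendsto_const_nhds.mul (ht.inv₀ one_ne_zero)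
  have hmem := himg.mem_of_tendsto hlim (Eventually.of_forall ?_)
  · obtain ⟨v, hv, hvu⟩ := hmem
    exact ⟨v, hv, hvu⟩
  intro j
  have hmod : p ^ (m.totient * j) ≡ 1 [MOD m] := by
    rw [pow_mul]
    simpa using (Nat.ModEq.pow_totient hcop).pow j
  have hpos : 1 ≤ p ^ (m.totient * j) := Nat.one_le_pow _ _ hp.out.pos
  obtain ⟨c, hc⟩ := (Nat.modEq_iff_dvd' hpos).1 hmod.symm
  refine ⟨(u ^ c)⁻¹, aux_inv_sub_one _ (aux_pow_sub_one _ hu _), ?_⟩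
  have : p ^ (m.totient * j) = c * m + 1 := by rw [mul_comm c]; omega
  simp only [this, inv_pow, ← pow_mul, pow_succ]
  field_simp

lemma aux_sub_le_max {L : Type*} [NormedField L] [IsUltrametricDist L] (x y : L) :
    ‖x - y‖ ≤ max ‖x‖ ‖y‖ := by
  have := IsUltrametricDist.norm_add_le_max x (-y)
  rwa [norm_neg, ← sub_eq_add_neg] at this

lemma aux_minpoly_dvd {K L : Type*} [Field K] [Field L] [Algebra K L] {α : L} {m : ℕ} {c : K}
    (hm : 0 < m) (h : α ^ m = algebraMap K L c) : (minpoly K α).natDegree ≤ m := by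
  have hd : minpoly K α ∣ X ^ m - C c := minpoly.dvd _ _ (by simp [h])
  have := natDegree_le_of_dvd hd (X_pow_sub_C_ne_zero hm c)
  rwa [natDegree_X_pow_sub_C] at this

lemma aux_deg {L : Type*} [NormedField L] [NormedAlgebra ℚ_[p] L]
    [Algebra.IsAlgebraic ℚ_[p] L] {α : L} {m : ℕ} {c : ℚ_[p]} (hm : 0 < m)
    (h : α ^ m = algebraMap ℚ_[p] L c) (hc : ‖c‖ = (p : ℝ)⁻¹) :
    (minpoly ℚ_[p] α).natDegree = m := by
  refine le_antisymm (aux_minpoly_dvd hm h) (Nat.le_of_dvd ?_ (aux_deg_dvd α m ?_ hm))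
  · exact minpoly.natDegree_pos (Algebra.IsAlgebraic.isAlgebraic α).isIntegral
  · rw [← norm_pow, h, norm_algebraMap', hc]

/-- A primitive abelian extension generated by a root of unity has prime degree. -/
lemma aux_abelian {K L : Type*} [Field K] [Field L] [Algebra K L] [FiniteDimensional K L]
    (hprim : ∀ M : IntermediateField K L, M = ⊥ ∨ M = ⊤)
    (hn : 2 ≤ Module.finrank K L) (t : L) (m : ℕ) (hm : 0 < m) (ht : t ^ m = 1)
    (htop : K⟮t⟯ = ⊤) : (Module.finrank K L).Prime := by
  have hfo : 0 < orderOf t := orderOf_pos_iff.2 (isOfFinOrder_iff_pow_eq_one.2 ⟨m, hm, ht⟩)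
  have : NeZero (orderOf t) := ⟨hfo.ne'⟩
  have hcyc : IsCyclotomicExtension {orderOf t} K K⟮t⟯ :=
    (IsPrimitiveRoot.orderOf t).intermediateField_adjoin_isCyclotomicExtension K
  rw [htop] at hcyc
  have : IsCyclotomicExtension {orderOf t} K L :=
    IsCyclotomicExtension.equiv {orderOf t} K (⊤ : IntermediateField K L) IntermediateField.topEquiv
  have hab : IsAbelianGalois K L := IsCyclotomicExtension.isAbelianGalois {orderOf t} K L
  have hcard := IsGalois.card_aut_eq_finrank K L
  have : Nontrivial Gal(L/K) := by
    rw [← Finite.one_lt_card_iff_nontrivial]; omega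
  let _ : CommGroup Gal(L/K) := { (inferInstance : Group Gal(L/K)) with
    mul_comm := fun a b => mul_comm' a b }
  have : IsSimpleGroup Gal(L/K) := by
    refine ⟨fun H _ => ?_⟩
    rcases hprim (IntermediateField.fixedField H) with h | h
    · right
      rw [← IntermediateField.fixingSubgroup_fixedField H, h, IntermediateField.fixingSubgroup_bot]
    · left
      rw [← IntermediateField.fixingSubgroup_fixedField H, h, IntermediateField.fixingSubgroup_top]
  rw [← hcard]
  exact IsSimpleGroup.prime_card

lemma aux_unram {L : Type*} [NormedField L] [NormedAlgebra ℚ_[p] L] [FiniteDimensional ℚ_[p] L]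
    (hprim : ∀ M : IntermediateField ℚ_[p] L, M = ⊥ ∨ M = ⊤)
    (hn : 2 ≤ Module.finrank ℚ_[p] L) (x : L) (hx : ‖x‖ = 1)
    (hres : ∀ a : ℚ_[p], ¬ ‖x - algebraMap ℚ_[p] L a‖ < 1) :
    (Module.finrank ℚ_[p] L).Prime := by
  have : IsUltrametricDist L := IsUltrametricDist.of_normedAlgebra ℚ_[p]
  have : ProperSpace L := FiniteDimensional.proper ℚ_[p] L
  have hx0 : x ≠ 0 := by rintro rfl; simp at hx
  -- some power of `x` is close to `1`
  obtain ⟨m, hm, hxm⟩ : ∃ m : ℕ, 0 < m ∧ ‖x ^ m - 1‖ < 1 := by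
    obtain ⟨a, -, φ, hφ, hlim⟩ := (isCompact_closedBall (0 : L) 1).tendsto_subseq
      (x := fun i : ℕ => x ^ i) (fun i => by simp [hx])
    obtain ⟨N, hN⟩ := Metric.cauchySeq_iff.1 hlim.cauchySeq 1 one_pos
    have h := hN (N + 1) (by omega) N le_rfl
    have hlt : φ N < φ (N + 1) := hφ (by omega)
    refine ⟨φ (N + 1) - φ N, by omega, ?_⟩
    have e : x ^ φ (N + 1) = x ^ (φ (N + 1) - φ N) * x ^ φ N := by
      rw [← pow_add]; congr 1; omega
    simp only [Function.comp_apply] at h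
    rw [dist_eq_norm, e, ← sub_one_mul, norm_mul, norm_pow, hx, one_pow, mul_one] at h
    exact h
  obtain ⟨a, m', hm', rfl⟩ := Nat.exists_eq_pow_mul_and_not_dvd hm.ne' p hp.out.ne_one
  have hxm' : ‖x ^ m' - 1‖ < 1 := by
    set t := x ^ m' - 1 with ht
    have ht1 : ‖t‖ ≤ 1 := by
      refine (aux_sub_le_max _ _).trans ?_
      simp [hx]
    have h := aux_binom (p := p) 1 t (by simp) ht1 a
    have e : t ^ (p ^ a) = (x ^ (p ^ a * m') - 1) -
        ((1 + t) ^ (p ^ a) - 1 ^ (p ^ a) - t ^ (p ^ a)) := by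
      rw [mul_comm (p ^ a), pow_mul, ht]; ring
    have h2 : ‖t ^ (p ^ a)‖ < 1 := by
      rw [e]
      refine (aux_sub_le_max _ _).trans_lt (max_lt hxm (h.trans_lt ?_))
      rw [norm_one, one_mul]
      exact mul_lt_one_of_nonneg_of_lt_one_left aux_inv_pos.le aux_inv_lt ht1
    rw [norm_pow] at h2
    exact (pow_lt_one_iff_of_nonneg (norm_nonneg _) (pow_pos hp.out.pos a).ne').1 h2
  obtain ⟨v, hv, hvx⟩ := aux_root (p := p) _ hxm' m' hm'
  have hv1 : ‖v‖ = 1 := by simpa using aux_norm_one v 1 (by simpa using hv)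
  have hv0 : v ≠ 0 := by rintro rfl; simp at hv1
  have htx : ‖x - x / v‖ < 1 := by
    have : x - x / v = x / v * (v - 1) := by field_simp
    rw [this, norm_mul, norm_div, hx, hv1]
    simpa using hv
  rcases hprim ℚ_[p]⟮x / v⟯ with h | h
  · exfalso
    rw [IntermediateField.adjoin_simple_eq_bot_iff, IntermediateField.mem_bot] at h
    obtain ⟨a, ha⟩ := h
    exact hres a (by rwa [ha])
  · have hm0 : 0 < m' := Nat.pos_of_ne_zero (by rintro rfl; simp at hm')
    refine aux_abelian hprim hn (x / v) m' hm0 ?_ h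
    rw [div_pow, hvx, div_self (pow_ne_zero _ hx0)]

/-- Existence of a uniformizer. -/
lemma aux_unif {L : Type*} [NormedField L] [NormedAlgebra ℚ_[p] L] [FiniteDimensional ℚ_[p] L] :
    ∃ ϖ : L, ϖ ≠ 0 ∧ ‖ϖ‖ < 1 ∧ ∀ x : L, x ≠ 0 → ∃ j : ℤ, ‖x‖ = ‖ϖ‖ ^ j := by
  classical
  set n := Module.finrank ℚ_[p] L with hn
  have hn0 : 0 < n := Module.finrank_pos
  have hdisc : ∀ x : L, x ≠ 0 → ∃ z : ℤ, ‖x‖ ^ n = (p : ℝ) ^ z := fun x hx =>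
    aux_norm_pow_dvd x hx n (minpoly.degree_dvd (Algebra.IsIntegral.isIntegral x))
  have hp1 := aux_one_lt (p := p)
  have hex : ∃ i : ℕ, 0 < i ∧ ∃ x : L, x ≠ 0 ∧ ‖x‖ ^ n = (p : ℝ) ^ (-(i : ℤ)) := by
    refine ⟨n, hn0, (p : L), ?_, ?_⟩
    · rw [← norm_pos_iff, aux_norm_p (p := p)]; exact aux_inv_pos
    · rw [aux_norm_p (p := p), zpow_neg, zpow_natCast, inv_pow]
  obtain ⟨hi0, ϖ, hϖ0, hϖ⟩ := Nat.find_spec hex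
  set i := Nat.find hex with hi
  have hϖ1 : ‖ϖ‖ < 1 := by
    rw [← pow_lt_one_iff_of_nonneg (norm_nonneg _) hn0.ne', hϖ]
    exact zpow_lt_one_of_neg₀ hp1 (by omega)
  refine ⟨ϖ, hϖ0, hϖ1, fun x hx => ?_⟩
  obtain ⟨z, hz⟩ := hdisc x hx
  -- divide `-z` by `i`
  have hdm := Int.emod_add_mul_ediv (-z) i
  have hr0 := Int.emod_nonneg (-z) (b := (i : ℤ)) (by omega)
  have hr1 := Int.emod_lt_of_pos (-z) (b := (i : ℤ)) (by omega)
  set r := (-z) % (i : ℤ)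
  set c := (-z) / (i : ℤ)
  have hy : ‖x / ϖ ^ c‖ ^ n = (p : ℝ) ^ (-r) := by
    rw [norm_div, norm_zpow, div_pow, hz, ← zpow_natCast, ← zpow_mul, mul_comm c, zpow_mul,
      zpow_natCast, hϖ, ← zpow_mul, ← zpow_sub₀ (by linarith)]
    congr 1
    linarith
  have hrz : r = 0 := by
    by_contra hne
    have hlt : r.toNat < i := by omega
    refine Nat.find_min hex hlt ⟨by omega, x / ϖ ^ c, div_ne_zero hx (zpow_ne_zero _ hϖ0), ?_⟩
    rw [hy, Int.toNat_of_nonneg hr0]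
  refine ⟨c, ?_⟩
  rw [hrz, neg_zero, zpow_zero, pow_eq_one_iff_of_nonneg (norm_nonneg _) hn0.ne', norm_div,
    norm_zpow, div_eq_one_iff_eq] at hy
  · exact hy
  · exact zpow_ne_zero _ (norm_ne_zero_iff.2 hϖ0)

lemma aux_forward {L : Type*} [NormedField L] [NormedAlgebra ℚ_[p] L] [FiniteDimensional ℚ_[p] L]
    (hprim : ∀ M : IntermediateField ℚ_[p] L, M = ⊥ ∨ M = ⊤)
    (hn : 2 ≤ Module.finrank ℚ_[p] L) :
    (Module.finrank ℚ_[p] L).Prime ∨ ∃ k : ℕ, Module.finrank ℚ_[p] L = p ^ k := by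
  by_cases hres : ∀ x : L, ‖x‖ = 1 → ∃ a : ℚ_[p], ‖x - algebraMap ℚ_[p] L a‖ < 1
  swap
  · push Not at hres
    obtain ⟨x, hx, hxa⟩ := hres
    exact Or.inl (aux_unram hprim hn x hx (fun a => (hxa a).not_gt))
  have : IsUltrametricDist L := IsUltrametricDist.of_normedAlgebra ℚ_[p]
  have : ProperSpace L := FiniteDimensional.proper ℚ_[p] L
  obtain ⟨ϖ, hϖ0, hϖ1, hval⟩ := aux_unif (p := p) (L := L)
  have hϖp : 0 < ‖ϖ‖ := norm_pos_iff.2 hϖ0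
  set n := Module.finrank ℚ_[p] L with hndef
  have hinj : ∀ a b : ℤ, ‖ϖ‖ ^ a = ‖ϖ‖ ^ b → a = b := fun a b h =>
    zpow_right_injective₀ hϖp hϖ1.ne h
  have hpL : (p : L) ≠ 0 := by
    rw [← norm_pos_iff, aux_norm_p (p := p)]; exact aux_inv_pos
  obtain ⟨e', he'⟩ := hval p hpL
  have he'pos : 0 < e' := by
    by_contra hle
    have h1 : 1 ≤ ‖ϖ‖ ^ e' := one_le_zpow_of_nonpos₀ hϖp hϖ1.le (by omega)
    rw [← he', aux_norm_p (p := p)] at h1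
    exact absurd aux_inv_lt (not_lt.2 h1)
  obtain ⟨e, rfl⟩ := Int.eq_ofNat_of_zero_le he'pos.le
  have he0 : 0 < e := by omega
  rw [aux_norm_p (p := p)] at he'
  have hdvd : (e : ℤ) ∣ n := by
    obtain ⟨z, hz⟩ := aux_norm_pow_dvd (p := p) ϖ hϖ0 n
      (minpoly.degree_dvd (Algebra.IsIntegral.isIntegral ϖ))
    refine ⟨-z, hinj _ _ ?_⟩
    rw [zpow_natCast, hz, zpow_mul, ← he', zpow_neg, inv_zpow, inv_inv]
  -- approximations
  let W : Submodule ℚ_[p] L := Submodule.span ℚ_[p] (Set.range fun i : Fin e => ϖ ^ (i : ℕ))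
  have happ : ∀ x : L, x ≠ 0 → ∃ w ∈ W, ‖x - w‖ < ‖x‖ := by
    intro x hx
    obtain ⟨j, hj⟩ := hval x hx
    have hdm := Int.emod_add_mul_ediv j e
    have hr0 := Int.emod_nonneg j (b := (e : ℤ)) (by omega)
    have hr1 := Int.emod_lt_of_pos j (b := (e : ℤ)) (by omega)
    set r := j % (e : ℤ)
    set c := j / (e : ℤ)
    obtain ⟨i, hi⟩ := Int.eq_ofNat_of_zero_le hr0
    set y : L := (p : L) ^ c * ϖ ^ i with hy
    have hy0 : y ≠ 0 := mul_ne_zero (zpow_ne_zero _ hpL) (pow_ne_zero _ hϖ0)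
    have hyn : ‖y‖ = ‖x‖ := by
      rw [hy, norm_mul, norm_zpow, norm_pow, aux_norm_p (p := p), he', hj, ← zpow_mul,
        ← zpow_natCast, ← zpow_add₀ hϖp.ne']
      congr 1
      rw [← hdm, hi]; ring
    obtain ⟨a, ha⟩ := hres (x / y) (by
      rw [norm_div, hyn, div_self (norm_ne_zero_iff.2 hx)])
    refine ⟨algebraMap ℚ_[p] L a * y, ?_, ?_⟩
    · have : algebraMap ℚ_[p] L a * y = (a * (p : ℚ_[p]) ^ c) • ϖ ^ i := by
        rw [Algebra.smul_def, map_mul, map_zpow₀, map_natCast, hy, mul_assoc]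
      rw [this]
      exact W.smul_mem _ (Submodule.subset_span ⟨⟨i, by omega⟩, rfl⟩)
    · have : x - algebraMap ℚ_[p] L a * y = (x / y - algebraMap ℚ_[p] L a) * y := by
        field_simp
      rw [this, norm_mul, hyn]
      exact mul_lt_of_lt_one_left (norm_pos_iff.2 hx) ha
  have hW : W = ⊤ := by
    rw [Submodule.eq_top_iff']
    intro x
    obtain ⟨w, hw, hxw⟩ := W.closed_of_finiteDimensional.exists_infDist_eq_dist ⟨0, W.zero_mem⟩ x
    by_cases h0 : x - w = 0
    · rw [sub_eq_zero.1 h0]; exact hw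
    · exfalso
      obtain ⟨w', hw', hlt⟩ := happ _ h0
      have h1 := Metric.infDist_le_dist_of_mem (x := x) (W.add_mem hw hw')
      have h2 : dist x (w + w') = ‖x - w - w'‖ := by rw [dist_eq_norm, sub_sub]
      rw [← dist_eq_norm x w, ← hxw, ← h2] at hlt
      exact absurd h1 (not_le.2 hlt)
  have hle : n ≤ e := by
    have := finrank_range_le_card (R := ℚ_[p]) (fun i : Fin e => ϖ ^ (i : ℕ))
    rw [Set.finrank] at this
    change Module.finrank ℚ_[p] W ≤ _ at this
    rwa [hW, finrank_top, Fintype.card_fin] at this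
  have hen : n = e := le_antisymm hle (Nat.le_of_dvd (by omega) (by exact_mod_cast hdvd))
  -- the tame part
  obtain ⟨k, m, hm, hkm⟩ := Nat.exists_eq_pow_mul_and_not_dvd (show n ≠ 0 by omega) p hp.out.ne_one
  have hm0 : 0 < m := Nat.pos_of_ne_zero (by rintro rfl; simp at hm)
  have hu : ‖ϖ ^ n / p‖ = 1 := by
    rw [norm_div, norm_pow, aux_norm_p (p := p), he', zpow_natCast, hen,
      div_self (pow_ne_zero _ hϖp.ne')]
  obtain ⟨a, ha⟩ := hres _ hu
  have ha1 : ‖algebraMap ℚ_[p] L a‖ = 1 := by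
    rw [← hu]
    refine aux_norm_one _ _ ?_
    rw [norm_sub_rev, hu]; exact ha
  have ha0 : algebraMap ℚ_[p] L a ≠ 0 := by
    rw [← norm_pos_iff, ha1]; exact one_pos
  have hu1 : ‖ϖ ^ n / p / algebraMap ℚ_[p] L a - 1‖ < 1 := by
    rw [← div_self ha0, ← sub_div, norm_div, ha1, div_one]; exact ha
  obtain ⟨v, hv, hvu⟩ := aux_root (p := p) _ hu1 m hm
  set α : L := ϖ ^ (p ^ k) / v with hα
  set c : ℚ_[p] := p * a with hc
  have hcn : ‖c‖ = (p : ℝ)⁻¹ := by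
    rw [norm_algebraMap'] at ha1
    rw [hc, norm_mul, Padic.norm_p, ha1, mul_one]
  have hαm : α ^ m = algebraMap ℚ_[p] L c := by
    rw [hα, div_pow, hvu, ← pow_mul, ← hkm, hc, map_mul, map_natCast]
    have := pow_ne_zero n hϖ0
    field_simp
  have hdeg : ∀ (β : L) (d : ℕ), 0 < d → β ^ d = algebraMap ℚ_[p] L c → d = 1 ∨ d = n := by
    intro β d hd hβ
    have h1 := aux_deg hd hβ hcn
    have h2 := IntermediateField.adjoin.finrank (Algebra.IsIntegral.isIntegral (R := ℚ_[p]) β)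
    rw [h1] at h2
    rcases hprim ℚ_[p]⟮β⟯ with h | h
    · left; rw [← h2, h, IntermediateField.finrank_bot]
    · right; rw [← h2, h, IntermediateField.finrank_top']
  rcases hdeg α m hm0 hαm with h | h
  · right; exact ⟨k, by rw [hkm, h, mul_one]⟩
  · left
    rw [Nat.prime_def]
    refine ⟨hn, fun d hd => ?_⟩
    obtain ⟨f, hf⟩ := hd
    refine hdeg (α ^ f) d (Nat.pos_of_ne_zero ?_) ?_
    · rintro rfl; omega
    · rw [← pow_mul, mul_comm f, ← hf, ← h, hαm]

lemma aux_tame (n : ℕ) (hn : n.Prime) : ∃ (L : Type) (_ : Field L) (_ : Algebra ℚ_[p] L),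
    Module.finrank ℚ_[p] L = n ∧ ∀ M : IntermediateField ℚ_[p] L, M = ⊥ ∨ M = ⊤ := by
  obtain ⟨α, hα⟩ := IsAlgClosed.exists_pow_nat_eq (k := PadicAlgCl p)
    (algebraMap ℚ_[p] (PadicAlgCl p) p) hn.pos
  have h1 := aux_deg hn.pos hα Padic.norm_p
  have h2 := IntermediateField.adjoin.finrank (Algebra.IsIntegral.isIntegral (R := ℚ_[p]) α)
  rw [h1] at h2
  have hfd : FiniteDimensional ℚ_[p] ℚ_[p]⟮α⟯ :=
    IntermediateField.adjoin.finiteDimensional (Algebra.IsIntegral.isIntegral (R := ℚ_[p]) α)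
  refine ⟨ℚ_[p]⟮α⟯, inferInstance, inferInstance, h2, fun M => ?_⟩
  have h3 := Module.finrank_mul_finrank ℚ_[p] M ℚ_[p]⟮α⟯
  rw [h2] at h3
  rcases (Nat.dvd_prime hn).1 ⟨_, h3.symm⟩ with h | h
  · left; exact IntermediateField.finrank_eq_one_iff.1 h
  · right
    rw [h] at h3
    exact IntermediateField.finrank_eq_one_iff_eq_top.1 (Nat.eq_of_mul_eq_mul_left hn.pos
      (by rw [h3, mul_one]))

lemma aux_wild (k : ℕ) (hk : k ≠ 0) : ∃ (L : Type) (_ : Field L) (_ : Algebra ℚ_[p] L),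
    Module.finrank ℚ_[p] L = p ^ k ∧ ∀ M : IntermediateField ℚ_[p] L, M = ⊥ ∨ M = ⊤ := by
  classical
  set q := p ^ k with hq
  have hq2 : 2 ≤ q := hp.out.two_le.trans (Nat.le_self_pow hk p)
  have hp1 := aux_one_lt (p := p)
  let f : ℚ_[p][X] := X ^ q + (C (p : ℚ_[p]) * X + C (p : ℚ_[p]))
  have hfdeg : f.natDegree = q := by
    have h1 : (C (p : ℚ_[p]) * X + C (p : ℚ_[p])).natDegree ≤ 1 := natDegree_linear_le
    rw [natDegree_add_eq_left_of_natDegree_lt (by rw [natDegree_X_pow]; omega), natDegree_X_pow]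
  have hf0 : f ≠ 0 := by intro h; rw [h] at hfdeg; simp at hfdeg; omega
  obtain ⟨π, hπ⟩ := IsAlgClosed.exists_aeval_eq_zero (PadicAlgCl p) f
    (by rw [degree_eq_natDegree hf0, hfdeg]; exact_mod_cast (by omega : q ≠ 0))
  have haev : ∀ x : PadicAlgCl p, aeval x f = x ^ q + (p * x + p) := by
    intro x; simp [f]
  have hpn : ‖(p : PadicAlgCl p)‖ = (p : ℝ)⁻¹ := aux_norm_p
  -- every root has norm less than one
  have hlt : ∀ x : PadicAlgCl p, aeval x f = 0 → ‖x‖ < 1 := by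
    intro x hx
    rw [haev] at hx
    by_contra! hge
    have e : x ^ q = - (p * (x + 1)) := by linear_combination hx
    have h1 : ‖x‖ ^ q = (p : ℝ)⁻¹ * ‖x + 1‖ := by
      rw [← norm_pow, e, norm_neg, norm_mul, hpn]
    have h2 : ‖x + 1‖ ≤ ‖x‖ := by
      refine (IsUltrametricDist.norm_add_le_max _ _).trans ?_
      simp [hge]
    have h3 : ‖x‖ ≤ ‖x‖ ^ q := le_self_pow₀ hge (by omega)
    have h4 := aux_inv_lt (p := p)
    have h5 := aux_inv_pos (p := p)
    nlinarith
  have hπ1 := hlt π hπ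
  have hπq : ‖π‖ ^ q = (p : ℝ)⁻¹ := by
    have hx := hπ
    rw [haev] at hx
    have e : π ^ q = - (p * (π + 1)) := by linear_combination hx
    have h2 : ‖π + 1‖ = 1 := by
      simpa using aux_norm_one (π + 1) 1 (by simpa using hπ1)
    rw [← norm_pow, e, norm_neg, norm_mul, hpn, h2, mul_one]
  have hint : IsIntegral ℚ_[p] π := Algebra.IsIntegral.isIntegral (R := ℚ_[p]) π
  have hdeg : (minpoly ℚ_[p] π).natDegree = q := by
    refine le_antisymm ?_ (Nat.le_of_dvd (minpoly.natDegree_pos hint)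
      (aux_deg_dvd π q hπq (by omega)))
    rw [← hfdeg]
    exact natDegree_le_of_dvd (minpoly.dvd _ _ hπ) hf0
  -- differences of roots
  have hdiff : ∀ x : PadicAlgCl p, aeval x f = 0 → x ≠ π → ‖π - x‖ ^ (q - 1) = (p : ℝ)⁻¹ := by
    intro x hx hne
    have hx1 := hlt x hx
    rw [norm_sub_rev]
    set y := x - π with hy
    have hy0 : y ≠ 0 := sub_ne_zero.2 hne
    have hyp : 0 < ‖y‖ := norm_pos_iff.2 hy0
    have hy1 : ‖y‖ ≤ 1 := (aux_sub_le_max _ _).trans (max_le hx1.le hπ1.le)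
    have hb := aux_binom (p := p) π y hπ1.le hy1 k
    rw [← hq] at hb
    rw [haev] at hx
    have hπ' := hπ
    rw [haev] at hπ'
    have e : y ^ q - (-(p * y)) = - ((π + y) ^ q - π ^ q - y ^ q) := by
      have : π + y = x := by rw [hy]; ring
      rw [this, hy]
      linear_combination hx - hπ'
    have h1 : ‖y ^ q‖ = ‖-((p : PadicAlgCl p) * y)‖ := by
      refine aux_norm_one _ _ ?_
      rw [e, norm_neg, norm_neg, norm_mul, hpn]
      refine hb.trans_lt (mul_lt_mul_of_pos_left ?_ aux_inv_pos)
      exact mul_lt_of_lt_one_left hyp hπ1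
    rw [norm_neg, norm_mul, hpn, norm_pow] at h1
    have h2 : ‖y‖ ^ q = ‖y‖ ^ (q - 1) * ‖y‖ := by
      rw [← pow_succ]; congr 1; omega
    rw [h2] at h1
    exact mul_right_cancel₀ hyp.ne' h1
  have h2 := IntermediateField.adjoin.finrank hint
  rw [hdeg] at h2
  have hfd : FiniteDimensional ℚ_[p] ℚ_[p]⟮π⟯ := IntermediateField.adjoin.finiteDimensional hint
  refine ⟨ℚ_[p]⟮π⟯, inferInstance, inferInstance, h2, fun M => ?_⟩
  set γ : ℚ_[p]⟮π⟯ := AdjoinSimple.gen ℚ_[p] π with hγ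
  have hγπ : algebraMap ℚ_[p]⟮π⟯ (PadicAlgCl p) γ = π := AdjoinSimple.algebraMap_gen _ _
  have hγint : IsIntegral M γ := Algebra.IsIntegral.isIntegral γ
  have hMtop : M⟮γ⟯ = ⊤ := by
    have hK : ℚ_[p]⟮γ⟯ = ⊤ := by
      apply IntermediateField.lift_injective
      rw [IntermediateField.lift_adjoin_simple, IntermediateField.lift_top]
      rfl
    exact IntermediateField.adjoin_eq_top_of_adjoin_eq_top ℚ_[p] hK
  have hd : Module.finrank M ℚ_[p]⟮π⟯ = (minpoly M γ).natDegree := by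
    rw [← IntermediateField.adjoin.finrank hγint, hMtop, IntermediateField.finrank_top']
  set d := (minpoly M γ).natDegree with hddef
  have hdpos : 0 < d := minpoly.natDegree_pos hγint
  have hmul := Module.finrank_mul_finrank ℚ_[p] M ℚ_[p]⟮π⟯
  rw [h2, hd] at hmul
  -- the derivative of the minimal polynomial
  set g : (PadicAlgCl p)[X] := ((minpoly M γ).map (algebraMap M ℚ_[p]⟮π⟯)).map
    (algebraMap ℚ_[p]⟮π⟯ (PadicAlgCl p)) with hg
  have hgm : g.Monic := ((minpoly.monic hγint).map _).map _
  have hgdeg : g.natDegree = d := by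
    rw [hg, natDegree_map, natDegree_map]
  have hgsplit : g.Splits := IsAlgClosed.splits g
  have heval : ∀ Q : ℚ_[p]⟮π⟯[X], eval π (Q.map (algebraMap ℚ_[p]⟮π⟯ (PadicAlgCl p))) =
      algebraMap ℚ_[p]⟮π⟯ (PadicAlgCl p) (eval γ Q) := by
    intro Q
    have h3 := eval₂_at_apply (p := Q) (algebraMap ℚ_[p]⟮π⟯ (PadicAlgCl p)) γ
    rw [hγπ] at h3
    rw [eval_map]; exact h3
  have hgπ : g.IsRoot π := by
    rw [IsRoot, hg, heval, eval_map_algebraMap, minpoly.aeval, map_zero]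
  have hπmem : π ∈ g.roots := (mem_roots hgm.ne_zero).2 hgπ
  have hgsep : g.Separable := by
    refine Separable.map (Separable.map ?_)
    exact (minpoly.irreducible hγint).separable
  have hder := hgsplit.eval_root_derivative hgm hπmem
  have hgf : g ∣ f.map (algebraMap ℚ_[p] (PadicAlgCl p)) := by
    have h3 : minpoly M γ ∣ f.map (algebraMap ℚ_[p] M) := by
      refine minpoly.dvd _ _ ?_
      rw [aeval_map_algebraMap]
      apply (algebraMap ℚ_[p]⟮π⟯ (PadicAlgCl p)).injective
      rw [← aeval_algebraMap_apply, hγπ, hπ, map_zero]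
    have h4 := Polynomial.map_dvd (algebraMap ℚ_[p]⟮π⟯ (PadicAlgCl p))
      (Polynomial.map_dvd (algebraMap M ℚ_[p]⟮π⟯) h3)
    have h5 : ((f.map (algebraMap ℚ_[p] M)).map (algebraMap M ℚ_[p]⟮π⟯)).map
        (algebraMap ℚ_[p]⟮π⟯ (PadicAlgCl p)) = f.map (algebraMap ℚ_[p] (PadicAlgCl p)) := by
      rw [Polynomial.map_map (algebraMap ℚ_[p] M), ← IsScalarTower.algebraMap_eq,
        Polynomial.map_map, ← IsScalarTower.algebraMap_eq]
    rwa [h5] at h4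
  have hnodup : g.roots.Nodup := nodup_roots hgsep
  have hprod : ‖eval π (derivative g)‖ ^ (q - 1) = ((p : ℝ)⁻¹) ^ (d - 1) := by
    have hcard : (g.roots.erase π).card = d - 1 := by
      rw [Multiset.card_erase_of_mem hπmem, ← hgsplit.natDegree_eq_card_roots, hgdeg]; rfl
    have hnp : ∀ s : Multiset (PadicAlgCl p), (∀ x ∈ s, ‖π - x‖ ^ (q - 1) = (p : ℝ)⁻¹) →
        ‖(s.map fun x => π - x).prod‖ ^ (q - 1) = ((p : ℝ)⁻¹) ^ s.card := by
      intro s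
      induction s using Multiset.induction_on with
      | empty => intro _; simp
      | cons a s ih =>
        intro h
        rw [Multiset.map_cons, Multiset.prod_cons, norm_mul, mul_pow,
          h a (Multiset.mem_cons_self a s), ih (fun x hx => h x (Multiset.mem_cons_of_mem hx)),
          Multiset.card_cons, pow_succ, mul_comm]
    rw [hder, hnp, hcard]
    intro x hx
    have hxr : x ∈ g.roots := Multiset.mem_of_mem_erase hx
    refine hdiff x ?_ ?_
    · have := ((mem_roots hgm.ne_zero).1 hxr).dvd hgf
      rwa [IsRoot, eval_map_algebraMap] at this
    · rintro rfl
      exact (hnodup.notMem_erase) hx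
  set δ : ℚ_[p]⟮π⟯ := aeval γ (derivative (minpoly M γ)) with hδ
  have hδπ : algebraMap ℚ_[p]⟮π⟯ (PadicAlgCl p) δ = eval π (derivative g) := by
    rw [hg, derivative_map, derivative_map, heval, eval_map_algebraMap]
  have hne : eval π (derivative g) ≠ 0 := by
    intro h
    rw [h, norm_zero, zero_pow (by omega)] at hprod
    exact (pow_ne_zero _ (aux_inv_pos (p := p)).ne') hprod.symm
  obtain ⟨z, hz⟩ := aux_norm_pow_dvd (p := p) _ hne q (by
    rw [← hδπ, minpoly.algebraMap_eq (algebraMap ℚ_[p]⟮π⟯ (PadicAlgCl p)).injective, ← h2]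
    exact minpoly.degree_dvd (Algebra.IsIntegral.isIntegral δ))
  have hzz : (p : ℝ) ^ (z * ((q - 1 : ℕ) : ℤ)) = (p : ℝ) ^ (-(((d - 1) * q : ℕ) : ℤ)) := by
    rw [zpow_mul, ← hz, zpow_natCast, zpow_neg, zpow_natCast, ← inv_pow, pow_mul _ (d - 1), ← hprod,
      ← pow_mul, ← pow_mul, mul_comm]
  have hz2 := aux_zpow_inj hzz
  have hdvd : (q - 1) ∣ (d - 1) * q := by
    have : ((q - 1 : ℕ) : ℤ) ∣ (((d - 1) * q : ℕ) : ℤ) := ⟨-z, by linarith⟩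
    exact_mod_cast this
  have hcop : Nat.Coprime (q - 1) q := by
    have : q = q - 1 + 1 := by omega
    conv_rhs => rw [this]
    simp
  have hdvd2 := hcop.dvd_of_dvd_mul_right hdvd
  have hdq : d ≤ q := Nat.le_of_dvd (by omega) ⟨_, by rw [mul_comm]; exact hmul.symm⟩
  rcases Nat.eq_zero_or_pos (d - 1) with h | h
  · right
    exact IntermediateField.finrank_eq_one_iff_eq_top.1 (by rw [hd]; omega)
  · left
    have := Nat.le_of_dvd h hdvd2
    have hdq' : d = q := by omega
    rw [hdq'] at hmul
    exact IntermediateField.finrank_eq_one_iff.1 (Nat.eq_of_mul_eq_mul_right (by omega : 0 < q)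
      (by rw [hmul, one_mul]))

end aux

theorem primitive_extension_of_qp_iff (p : ℕ) [Fact p.Prime] (n : ℕ) (hn : 2 ≤ n) :
    (∃ (L : Type) (_ : Field L) (_ : Algebra ℚ_[p] L),
        Module.finrank ℚ_[p] L = n ∧
        ∀ M : IntermediateField ℚ_[p] L, M = ⊥ ∨ M = ⊤) ↔
      (n.Prime ∨ ∃ k : ℕ, n = p ^ k) := by
  constructor
  · rintro ⟨L, hL, hA, rfl, hprim⟩
    have hfd : FiniteDimensional ℚ_[p] L := FiniteDimensional.of_finrank_pos (by omega)
    let _ : NormedField L := spectralNorm.normedField ℚ_[p] L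
    let _ : NormedAlgebra ℚ_[p] L := spectralNorm.normedAlgebra ℚ_[p] L
    exact aux_forward hprim hn
  · rintro (h | ⟨k, rfl⟩)
    · exact aux_tame n h
    · refine aux_wild k ?_
      rintro rfl
      simp at hn
end

section
/- Let p be prime and n ≥ 2 with p not dividing n, and let q be the smallest prime factor of n. Then for any tower of finite field extensions ℚ_p ⊆ K ⊆ L with [L : K] = n, there exists an intermediate field M with K ⊆ M ⊆ L and [M : K] = q. -/
open Polynomial IsLocalRing

lemma aux_hensel {F : Type*} [NormedField F] [ProperSpace F]
    (hna : ∀ x y : F, ‖x + y‖ ≤ max ‖x‖ ‖y‖) {B : Type*} [CommRing B] [Algebra B F]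
    (hinj : Function.Injective (algebraMap B F))
    (hr : ∀ x : F, (∃ b, algebraMap B F b = x) ↔ ‖x‖ ≤ 1) : HenselianLocalRing B := by
  have hle (b : B) : ‖algebraMap B F b‖ ≤ 1 := (hr _).1 ⟨b, rfl⟩
  have hunit (b : B) : IsUnit b ↔ ‖algebraMap B F b‖ = 1 := by
    constructor
    · rintro ⟨u, rfl⟩
      have h1 : ‖algebraMap B F u‖ * ‖algebraMap B F (u⁻¹ : Bˣ)‖ = 1 := by
        rw [← norm_mul, ← map_mul]; simp
      have h2 := hle u
      have h3 := hle (u⁻¹ : Bˣ)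
      refine le_antisymm h2 ?_
      calc (1 : ℝ) = _ := h1.symm
        _ ≤ ‖algebraMap B F u‖ * 1 := by gcongr
        _ = _ := mul_one _
    · intro h
      have h0 : algebraMap B F b ≠ 0 := by
        intro h0; rw [h0] at h; simp at h
      obtain ⟨c, hc⟩ := (hr (algebraMap B F b)⁻¹).2 (by rw [norm_inv, h]; simp)
      refine IsUnit.of_mul_eq_one c (hinj ?_)
      rw [map_mul, hc, map_one, mul_inv_cancel₀ h0]
  have : Nontrivial B := ⟨0, 1, fun h => by
    have := congrArg (algebraMap B F) h
    simp at this⟩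
  have hnu (b : B) : b ∈ nonunits B ↔ ‖algebraMap B F b‖ < 1 := by
    rw [mem_nonunits_iff, hunit]
    exact ⟨fun h => lt_of_le_of_ne (hle b) h, fun h => h.ne⟩
  have hloc : IsLocalRing B := IsLocalRing.of_nonunits_add (by
    intro a b ha hb
    rw [hnu] at *
    rw [map_add]
    exact (hna _ _).trans_lt (max_lt ha hb))
  have hm (b : B) : b ∈ maximalIdeal B ↔ ‖algebraMap B F b‖ < 1 := by
    rw [mem_maximalIdeal, hnu]
  refine { hloc with is_henselian := ?_ }
  intro f _ a₀ h0 h1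
  obtain ⟨x, hx, hmin⟩ := (isCompact_closedBall (0 : F) 1).inter_right
      (isClosed_le (f := fun x : F => ‖x - algebraMap B F a₀‖)
        (g := fun _ => ‖algebraMap B F (f.eval a₀)‖) (by fun_prop) (by fun_prop))
    |>.exists_isMinOn (f := fun x => ‖(f.map (algebraMap B F)).eval x‖)
    ⟨algebraMap B F a₀, by simpa using hle a₀, by simp⟩
    (by fun_prop)
  obtain ⟨a, rfl⟩ := (hr x).2 (by simpa using hx.1)
  have hx2 : ‖algebraMap B F (a - a₀)‖ ≤ ‖algebraMap B F (f.eval a₀)‖ := by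
    rw [map_sub]; exact hx.2
  have hlt := (hm _).1 h0
  have ham : a - a₀ ∈ maximalIdeal B := (hm _).2 (hx2.trans_lt hlt)
  refine ⟨a, ?_, ham⟩
  have hfa : ‖algebraMap B F (f.eval a)‖ ≤ ‖algebraMap B F (f.eval a₀)‖ := by
    have := hmin (a := algebraMap B F a₀) ⟨by simpa using hle a₀, by simp⟩
    simpa [eval_map_algebraMap, aeval_algebraMap_apply] using this
  have hd : IsUnit (f.derivative.eval a) := by
    by_contra hd
    have hd : f.derivative.eval a ∈ maximalIdeal B := hd
    have h3 := Ideal.mem_of_dvd _ (sub_dvd_eval_sub a a₀ f.derivative) ham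
    have h4 : f.derivative.eval a₀ ∈ maximalIdeal B := by
      simpa using Ideal.sub_mem _ hd h3
    exact h4 h1
  obtain ⟨u, hu⟩ := hd
  by_contra hne
  have hpos : 0 < ‖algebraMap B F (f.eval a)‖ := by
    rw [norm_pos_iff]
    intro h
    exact hne (hinj (by rw [h, map_zero]))
  obtain ⟨c, hc⟩ := f.binomExpansion a (-(f.eval a * (u⁻¹ : Bˣ)))
  have hc' : f.eval (a + -(f.eval a * (u⁻¹ : Bˣ))) =
      f.eval a * (f.eval a * (c * (u⁻¹ : Bˣ) ^ 2)) := by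
    rw [hc, ← hu]
    have : (u : B) * (u⁻¹ : Bˣ) = 1 := by simp
    linear_combination (- eval a f) * this
  have h5 : ‖algebraMap B F (f.eval a)‖ ≤
      ‖algebraMap B F (f.eval (a + -(f.eval a * (u⁻¹ : Bˣ))))‖ := by
    have := hmin (a := algebraMap B F (a + -(f.eval a * (u⁻¹ : Bˣ)))) ⟨mem_closedBall_zero_iff.2 (hle _), by
      change ‖_ - _‖ ≤ _
      rw [← map_sub]
      have : a + -(eval a f * ↑u⁻¹) - a₀ = (a - a₀) + (eval a f * (-↑u⁻¹)) := by ring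
      rw [this, map_add]
      refine (hna _ _).trans (max_le hx2 ?_)
      rw [map_mul, norm_mul]
      exact (mul_le_of_le_one_right (norm_nonneg _) (hle _)).trans hfa⟩
    simpa only [Set.mem_ofPred_eq, eval_map_algebraMap, aeval_algebraMap_apply,
      coe_aeval_eq_eval] using this
  rw [hc', map_mul, map_mul, norm_mul, norm_mul] at h5
  have h6 : ‖algebraMap B F (f.eval a)‖ * ‖algebraMap B F (c * (u⁻¹ : Bˣ) ^ 2)‖ < 1 :=
    (mul_le_of_le_one_right (norm_nonneg _) (hle _)).trans_lt (hfa.trans_lt hlt)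
  nlinarith

lemma aux_integral_iff (p : ℕ) [Fact p.Prime] (L : Type*) [Field L] [Algebra ℚ_[p] L]
    [Algebra ℤ_[p] L] [IsScalarTower ℤ_[p] ℚ_[p] L]
    [FiniteDimensional ℚ_[p] L] (x : L) : IsIntegral ℤ_[p] x ↔ spectralNorm ℚ_[p] L x ≤ 1 := by
  have hx : IsIntegral ℚ_[p] x := Algebra.IsIntegral.isIntegral x
  rw [spectralNorm, spectralValue_le_one_iff (minpoly.monic hx)]
  constructor
  · intro h n
    rw [minpoly.isIntegrallyClosed_eq_field_fractions' ℚ_[p] h, coeff_map]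
    exact PadicInt.norm_le_one _
  · intro h
    have hl : minpoly ℚ_[p] x ∈ lifts (algebraMap ℤ_[p] ℚ_[p]) := by
      rw [lifts_iff_coeff_lifts]
      intro n
      exact ⟨⟨_, h n⟩, rfl⟩
    obtain ⟨g, hg, -, hgm⟩ := lifts_and_natDegree_eq_and_monic hl (minpoly.monic hx)
    refine ⟨g, hgm, ?_⟩
    have := minpoly.aeval ℚ_[p] x
    rwa [← hg, aeval_map_algebraMap] at this

lemma aux_ring (p : ℕ) [Fact p.Prime] (L : Type*) [Field L] [Algebra ℚ_[p] L]
    [Algebra ℤ_[p] L] [IsScalarTower ℤ_[p] ℚ_[p] L] [FiniteDimensional ℚ_[p] L]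
    (B : Type*) [CommRing B] [IsDomain B] [Algebra B L] [Algebra ℤ_[p] B] [IsScalarTower ℤ_[p] B L]
    [IsIntegralClosure B ℤ_[p] L] :
    HenselianLocalRing B ∧ IsDiscreteValuationRing B ∧ IsFractionRing B L ∧
      Module.Finite ℤ_[p] B := by
  have hinj : Function.Injective (algebraMap B L) := IsIntegralClosure.algebraMap_injective B ℤ_[p] L
  have hfin : Module.Finite ℤ_[p] B := IsIntegralClosure.finite ℤ_[p] ℚ_[p] L B
  have hfrac : IsFractionRing B L := IsIntegralClosure.isFractionRing_of_finite_extension ℤ_[p] ℚ_[p] L B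
  have hded : IsDedekindDomain B := IsIntegralClosure.isDedekindDomain ℤ_[p] ℚ_[p] L B
  have hH : HenselianLocalRing B := by
    let := spectralNorm.normedField ℚ_[p] L
    let := spectralNorm.normedAlgebra ℚ_[p] L
    have : ProperSpace L := FiniteDimensional.proper ℚ_[p] L
    refine aux_hensel (F := L) (B := B) ?_ hinj ?_
    · exact fun x y => isNonarchimedean_spectralNorm x y
    · intro x
      rw [← IsIntegralClosure.isIntegral_iff (A := B) (R := ℤ_[p]), aux_integral_iff]
      rfl
  have hp : Algebra.IsIntegral ℤ_[p] B := inferInstance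
  refine ⟨hH, ?_, hfrac, hfin⟩
  have hnf : ¬ IsField B := by
    intro h
    have hi : Function.Injective (algebraMap ℤ_[p] B) := by
      have : Function.Injective (algebraMap ℤ_[p] L) := by
        rw [IsScalarTower.algebraMap_eq ℤ_[p] ℚ_[p] L]
        exact (algebraMap ℚ_[p] L).injective.comp (IsFractionRing.injective _ _)
      rw [IsScalarTower.algebraMap_eq ℤ_[p] B L] at this
      exact Function.Injective.of_comp this
    exact IsDiscreteValuationRing.not_isField ℤ_[p] (isField_of_isIntegral_of_isField hi h)
  exact ((IsDiscreteValuationRing.TFAE B hnf).out 0 2).2 hded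


lemma aux_coprime (q f Q : ℕ) (hq : q.Prime) (hf : ¬ q ∣ f) (hf0 : f ≠ 0)
    (hmin : ∀ r : ℕ, r.Prime → r ∣ f → q ≤ r) : Nat.Coprime (∑ i ∈ Finset.range f, Q ^ i) q := by
  rw [Nat.coprime_comm, hq.coprime_iff_not_dvd]
  intro h
  have := Fact.mk hq
  have h1 : (∑ i ∈ Finset.range f, (Q : ZMod q) ^ i) = 0 := by
    have := (ZMod.natCast_eq_zero_iff _ q).2 h
    simpa using this
  have h2 : (Q : ZMod q) ^ f = 1 := by
    have := geom_sum_mul (Q : ZMod q) f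
    rw [h1, zero_mul] at this
    exact (sub_eq_zero.1 this.symm)
  have h3 : (Q : ZMod q) ≠ 0 := by
    intro h3; rw [h3, zero_pow hf0] at h2; exact zero_ne_one h2
  have h4 := ZMod.pow_card_sub_one_eq_one h3
  have h5 : Nat.Coprime f (q - 1) := by
    refine Nat.coprime_of_dvd fun r hr hrf hrq => ?_
    have := hmin r hr hrf
    have := Nat.le_of_dvd (by have := hq.two_le; omega) hrq
    have := hq.two_le
    omega
  have h6 : (Q : ZMod q) = 1 := by
    have := Nat.dvd_gcd (orderOf_dvd_of_pow_eq_one h2) (orderOf_dvd_of_pow_eq_one h4)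
    rw [h5.gcd_eq_one, Nat.dvd_one, orderOf_eq_one_iff] at this
    exact this
  rw [h6] at h1
  simp only [one_pow, Finset.sum_const, Finset.card_range, nsmul_eq_mul, mul_one] at h1
  exact hf ((ZMod.natCast_eq_zero_iff _ q).1 h1)

lemma aux_finite_field (k l : Type*) [Field k] [Field l] [Algebra k l] [Finite l] (q : ℕ)
    (hq : q.Prime) (hf : ¬ q ∣ Module.finrank k l)
    (hmin : ∀ r : ℕ, r.Prime → r ∣ Module.finrank k l → q ≤ r) (x : l) (hx : x ≠ 0) :
    ∃ v : k, v ≠ 0 ∧ ∃ y : l, y ≠ 0 ∧ y ^ q = algebraMap k l v * x := by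
  have : Finite k := Finite.of_injective _ (algebraMap k l).injective
  have : Module.Finite k l := Module.Finite.of_finite
  have hc := aux_coprime q (Module.finrank k l) (Nat.card k) hq hf Module.finrank_pos.ne' hmin
  have hN : algebraMap k l (Algebra.norm k x) =
      x ^ (∑ i ∈ Finset.range (Module.finrank k l), Nat.card k ^ i) := by
    rw [FiniteField.algebraMap_norm_eq_pow, Nat.geomSum_eq Finite.one_lt_card,
      ← Module.natCard_eq_pow_finrank]
  set s := ∑ i ∈ Finset.range (Module.finrank k l), Nat.card k ^ i
  have hb : (1 : ℤ) = s * s.gcdA q + q * s.gcdB q := by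
    rw [← Nat.gcd_eq_gcd_ab, hc.gcd_eq_one]; rfl
  refine ⟨(Algebra.norm k x) ^ (-(s.gcdA q)), zpow_ne_zero _ (by simpa using hx),
    x ^ (s.gcdB q), zpow_ne_zero _ hx, ?_⟩
  rw [map_zpow₀, hN, ← zpow_natCast, ← zpow_natCast, ← zpow_mul, ← zpow_mul, ← zpow_add_one₀ hx]
  congr 1
  linarith

lemma aux_exists_deg (k l : Type*) [Field k] [Field l] [Algebra k l] [Finite l] (q : ℕ)
    (hf : q ∣ Module.finrank k l) : ∃ x : l, (minpoly k x).natDegree = q := by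
  have : Finite k := Finite.of_injective _ (algebraMap k l).injective
  have : Module.Finite k l := Module.Finite.of_finite
  have hcard : Nat.card (l ≃ₐ[k] l) = Module.finrank k l := IsGalois.card_aut_eq_finrank k l
  obtain ⟨d, hd⟩ := hf
  have hpos : 0 < Module.finrank k l := Module.finrank_pos
  obtain ⟨g, hg⟩ := IsCyclic.exists_generator (α := l ≃ₐ[k] l)
  have hog : orderOf g = q * d := by rw [orderOf_eq_card_of_forall_mem_zpowers hg, hcard, hd]
  have hq : q ≠ 0 := by rintro rfl; simp at hd; omega
  have hd0 : d ≠ 0 := by rintro rfl; simp at hd; omega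
  let H := Subgroup.zpowers (g ^ q)
  have hH : Nat.card H = d := by
    rw [Nat.card_zpowers, orderOf_pow_of_dvd hq (hog ▸ dvd_mul_right _ _), hog]
    exact Nat.mul_div_cancel_left _ (Nat.pos_of_ne_zero hq)
  let E := IntermediateField.fixedField H
  have hE : Module.finrank E l = d := by
    rw [IntermediateField.finrank_fixedField_eq_card, hH]
  have hE2 : Module.finrank k E = q := by
    have := Module.finrank_mul_finrank k E l
    rw [hE, hd] at this
    exact Nat.eq_of_mul_eq_mul_right (Nat.pos_of_ne_zero hd0) this
  obtain ⟨x, hx⟩ := Field.exists_primitive_element k E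
  refine ⟨x, ?_⟩
  have h1 := IntermediateField.adjoin.finrank (K := k) (x := x) (Algebra.IsIntegral.isIntegral x)
  rw [hx, IntermediateField.finrank_top', hE2] at h1
  rw [h1]
  congr 1
  exact minpoly.algebraMap_eq (algebraMap E l).injective x

lemma aux_adjoin {A K L : Type*} [CommRing A] [IsDomain A] [IsIntegrallyClosed A] [Field K]
    [Algebra A K] [IsFractionRing A K] [Field L] [Algebra K L] [Algebra A L] [IsScalarTower A K L]
    (g : A[X]) (hg : g.Monic) (hi : Irreducible g) (x : L) (hx : aeval x g = 0) :
    ∃ M : IntermediateField K L, Module.finrank K M = g.natDegree := by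
  refine ⟨IntermediateField.adjoin K {x}, ?_⟩
  have h1 := (hg.irreducible_iff_irreducible_map_fraction_map (K := K)).1 hi
  have h2 : aeval x (g.map (algebraMap A K)) = 0 := by rwa [aeval_map_algebraMap]
  have h3 := minpoly.eq_of_irreducible_of_monic h1 h2 (hg.map _)
  rw [IntermediateField.adjoin.finrank ⟨_, hg.map _, h2⟩, ← h3, hg.natDegree_map]

lemma aux_core {A B K L : Type*} [CommRing A] [IsDomain A] [IsDiscreteValuationRing A]
    [CommRing B] [IsDomain B] [IsDiscreteValuationRing B] [HenselianLocalRing B] [Algebra A B]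
    [Module.Finite A B] [IsLocalHom (algebraMap A B)] [Finite (ResidueField B)]
    [Field K] [Algebra A K] [IsFractionRing A K]
    [Field L] [Algebra B L] [IsFractionRing B L] [Algebra K L] [Algebra A L] [IsScalarTower A K L]
    [IsScalarTower A B L] (q : ℕ) (hq : q.Prime) (hqn : q ∣ Module.finrank K L)
    (hmin : ∀ r : ℕ, r.Prime → r ∣ Module.finrank K L → q ≤ r) (hqu : IsUnit (q : B)) :
    ∃ M : IntermediateField K L, Module.finrank K M = q := by
  have hens := ((HenselianLocalRing.TFAE B).out 0 1).1 ‹HenselianLocalRing B›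
  have hef := Ideal.ramificationIdx_mul_inertiaDeg_of_isLocalRing B K L (p := maximalIdeal A)
    (IsDiscreteValuationRing.not_a_field A)
  have hf : (maximalIdeal A).inertiaDeg' (maximalIdeal B) =
      Module.finrank (ResidueField A) (ResidueField B) := Ideal.inertiaDeg'_algebraMap _ _
  rw [hf] at hef
  by_cases hqf : q ∣ Module.finrank (ResidueField A) (ResidueField B)
  · obtain ⟨x, hx⟩ := aux_exists_deg _ _ q hqf
    have : Finite (ResidueField A) :=
      Finite.of_injective _ (algebraMap (ResidueField A) (ResidueField B)).injective
    have hxi : IsIntegral (ResidueField A) x := Algebra.IsIntegral.isIntegral x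
    obtain ⟨g, hg, hdeg, hgm⟩ := lifts_and_natDegree_eq_and_monic
      (f := residue A) (p := minpoly (ResidueField A) x)
      (by rw [lifts_iff_coeff_lifts]; exact fun n => residue_surjective _) (minpoly.monic hxi)
    have hgi : Irreducible g := hgm.irreducible_of_irreducible_map (residue A) g
      (by rw [hg]; exact minpoly.irreducible hxi)
    have hcomp (h : A[X]) : aeval x (h.map (algebraMap A B)) = aeval x (h.map (residue A)) := by
      rw [aeval_map_algebraMap, ← ResidueField.algebraMap_eq, aeval_map_algebraMap]
    obtain ⟨b, hb, -⟩ := hens (g.map (algebraMap A B)) (hgm.map _) x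
      (by rw [hcomp, hg, minpoly.aeval])
      (by
        rw [derivative_map, hcomp, ← derivative_map, hg]
        exact (Algebra.IsSeparable.isSeparable (ResidueField A) x).aeval_derivative_ne_zero
          (minpoly.aeval _ _))
    obtain ⟨M, hM⟩ := aux_adjoin (K := K) g hgm hgi (algebraMap B L b) (by
      rw [aeval_algebraMap_apply]
      rw [IsRoot.def, eval_map_algebraMap] at hb
      rw [hb, map_zero])
    exact ⟨M, by rw [hM, hdeg, hx]⟩
  · obtain ⟨ϖ, hϖ⟩ := IsDiscreteValuationRing.exists_irreducible A
    obtain ⟨ϖB, hϖB⟩ := IsDiscreteValuationRing.exists_irreducible B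
    have hinj : Function.Injective (algebraMap A B) :=
      algebraMap_injective_of_field_isFractionRing A B K L
    have h0 : algebraMap A B ϖ ≠ 0 := by
      rw [Ne, map_eq_zero_iff _ hinj]; exact hϖ.ne_zero
    obtain ⟨e, u, hu⟩ := IsDiscreteValuationRing.eq_unit_mul_pow_irreducible h0 hϖB
    have hmap : (maximalIdeal A).map (algebraMap A B) = maximalIdeal B ^ e := by
      rw [hϖ.maximalIdeal_eq, hϖB.maximalIdeal_eq, Ideal.map_span, Set.image_singleton, hu,
        Ideal.span_singleton_pow, Ideal.span_singleton_eq_span_singleton]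
      exact ⟨u⁻¹, by rw [mul_right_comm]; simp⟩
    have he : (maximalIdeal A).ramificationIdx' (maximalIdeal B) = e := by
      apply Ideal.ramificationIdx'_spec
      · exact hmap.le
      · rw [hmap, hϖB.maximalIdeal_eq, Ideal.span_singleton_pow, Ideal.span_singleton_pow,
          Ideal.span_singleton_le_span_singleton,
          pow_dvd_pow_iff hϖB.ne_zero hϖB.not_isUnit]
        omega
    rw [he] at hef
    have hqe : q ∣ e := by
      rw [← hef] at hqn
      exact (hq.dvd_mul.1 hqn).resolve_right hqf
    obtain ⟨d, rfl⟩ := hqe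
    obtain ⟨v, hv0, y, hy0, hy⟩ := aux_finite_field (ResidueField A) (ResidueField B) q hq hqf
      (fun r hr hrf => hmin r hr (hef ▸ hrf.mul_left _)) (residue B u) (by
        rw [Ne, residue_eq_zero_iff]; exact fun h => h u.isUnit)
    obtain ⟨v, rfl⟩ := residue_surjective v
    have hvu : IsUnit v := by
      rw [Ne, residue_eq_zero_iff] at hv0
      exact not_not.1 hv0
    have hy' : y ^ q = residue B (algebraMap A B v * u) := by
      rw [hy, map_mul, ResidueField.algebraMap_residue]
    obtain ⟨z, hz, -⟩ := hens (X ^ q - C (algebraMap A B v * u)) (monic_X_pow_sub_C _ hq.ne_zero) y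
      (by simp only [map_sub, map_pow, aeval_X, aeval_C, ResidueField.algebraMap_eq, hy', sub_self])
      (by
        have : residue B (q : B) ≠ 0 := by
          rw [Ne, residue_eq_zero_iff]; exact fun h => h hqu
        rw [map_natCast] at this
        simp [derivative_X_pow, hy0, this])
    have hz' : z ^ q = algebraMap A B v * u := by
      simpa [sub_eq_zero] using hz
    have hvϖ : Irreducible (v * ϖ) := (irreducible_isUnit_mul hvu).2 hϖ
    have hmon : (X ^ q - C (v * ϖ) : A[X]).Monic := monic_X_pow_sub_C _ hq.ne_zero
    have hnd : (X ^ q - C (v * ϖ) : A[X]).natDegree = q := natDegree_X_pow_sub_C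
    have heis : Irreducible (X ^ q - C (v * ϖ) : A[X]) := by
      refine IsEisensteinAt.irreducible (𝓟 := maximalIdeal A) ⟨?_, ?_, ?_⟩ inferInstance
        hmon.isPrimitive (by rw [hnd]; exact hq.pos)
      · rw [hmon.leadingCoeff]
        exact fun h => h isUnit_one
      · intro n hn
        rw [hnd] at hn
        rw [coeff_sub, coeff_X_pow, if_neg hn.ne, coeff_C]
        split_ifs
        · rw [zero_sub, neg_mem_iff]; exact hvϖ.not_isUnit
        · simp
      · rw [coeff_sub, coeff_X_pow, if_neg hq.ne_zero.symm, coeff_C_zero, zero_sub, neg_mem_iff,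
          hvϖ.maximalIdeal_eq, Ideal.span_singleton_pow, Ideal.mem_span_singleton]
        intro h
        have := (pow_dvd_pow_iff (m := 1) hvϖ.ne_zero hvϖ.not_isUnit).1 (by simpa using h)
        omega
    obtain ⟨M, hM⟩ := aux_adjoin (K := K) _ hmon heis (algebraMap B L (z * ϖB ^ d)) (by
      rw [aeval_algebraMap_apply]
      have : aeval (z * ϖB ^ d) (X ^ q - C (v * ϖ)) = 0 := by
        simp only [map_sub, map_pow, aeval_X, aeval_C, map_mul, hu, mul_pow, hz']
        ring
      rw [this, map_zero])
    exact ⟨M, by rw [hM, hnd]⟩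

theorem exists_subextension_of_minFac_degree (p n : ℕ) [Fact p.Prime] (hn : 2 ≤ n)
    (hpn : ¬p ∣ n)
    (K L : Type) [Field K] [Field L] [Algebra ℚ_[p] K] [Algebra K L] [Algebra ℚ_[p] L]
    [IsScalarTower ℚ_[p] K L] [FiniteDimensional ℚ_[p] K] [FiniteDimensional K L]
    (hLK : Module.finrank K L = n) :
    ∃ M : IntermediateField K L, Module.finrank K M = n.minFac := by
  let iK : Algebra ℤ_[p] K := ((algebraMap ℚ_[p] K).comp (algebraMap ℤ_[p] ℚ_[p])).toAlgebra
  let iL : Algebra ℤ_[p] L := ((algebraMap ℚ_[p] L).comp (algebraMap ℤ_[p] ℚ_[p])).toAlgebra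
  have t1 : IsScalarTower ℤ_[p] ℚ_[p] K := IsScalarTower.of_algebraMap_eq fun _ => rfl
  have t2 : IsScalarTower ℤ_[p] ℚ_[p] L := IsScalarTower.of_algebraMap_eq fun _ => rfl
  have t3 : IsScalarTower ℤ_[p] K L := IsScalarTower.of_algebraMap_eq fun x =>
    IsScalarTower.algebraMap_apply ℚ_[p] K L x
  have : FiniteDimensional ℚ_[p] L := FiniteDimensional.trans ℚ_[p] K L
  let A := integralClosure ℤ_[p] K
  have tA : IsScalarTower ℤ_[p] A L := IsScalarTower.of_algebraMap_eq fun x =>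
    IsScalarTower.algebraMap_apply ℤ_[p] K L x
  have hAint : Algebra.IsIntegral ℤ_[p] A := inferInstance
  let B := integralClosure A L
  have hB : IsIntegralClosure B ℤ_[p] L := by
    refine ⟨Subtype.val_injective, fun {x} => ⟨fun h => ?_, ?_⟩⟩
    · exact ⟨⟨x, h.tower_top⟩, rfl⟩
    · rintro ⟨y, rfl⟩
      exact isIntegral_trans (R := ℤ_[p]) (A := A) _ y.2
  obtain ⟨hA1, hA2, hA3, hA4⟩ := aux_ring p K A
  obtain ⟨hB1, hB2, hB3, hB4⟩ := aux_ring p L B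
  have hAB : Module.Finite A B := Module.Finite.of_restrictScalars_finite ℤ_[p] A B
  have hinj : Function.Injective (algebraMap A B) :=
    algebraMap_injective_of_field_isFractionRing A B K L
  have : FaithfulSMul A B := (faithfulSMul_iff_algebraMap_injective A B).2 hinj
  have hloc : IsLocalHom (algebraMap A B) := inferInstance
  have hloc2 : IsLocalHom (algebraMap ℤ_[p] B) := by
    have : Function.Injective (algebraMap ℤ_[p] B) := by
      have : Function.Injective (algebraMap ℤ_[p] L) :=
        (algebraMap ℚ_[p] L).injective.comp (IsFractionRing.injective ℤ_[p] ℚ_[p])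
      rw [IsScalarTower.algebraMap_eq ℤ_[p] B L] at this
      exact Function.Injective.of_comp (f := algebraMap B L) (by simpa using this)
    have : FaithfulSMul ℤ_[p] B := (faithfulSMul_iff_algebraMap_injective _ _).2 this
    infer_instance
  have hfin0 : Finite (ResidueField ℤ_[p]) :=
    Finite.of_equiv (ZMod p) (PadicInt.residueField (p := p)).symm.toEquiv
  have hfin : Finite (ResidueField B) := ResidueField.finite_of_finite hfin0
  have hq : n.minFac.Prime := Nat.minFac_prime (by omega)
  have hqu : IsUnit (n.minFac : B) := by
    have h1 : IsUnit (n.minFac : ℤ_[p]) := by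
      rw [PadicInt.isUnit_iff, PadicInt.norm_natCast_eq_one_iff]
      refine (Nat.coprime_primes Fact.out hq).2 ?_
      rintro h
      exact hpn (h ▸ Nat.minFac_dvd n)
    simpa using h1.map (algebraMap ℤ_[p] B)
  exact aux_core (A := A) (B := B) n.minFac hq (hLK ▸ Nat.minFac_dvd n)
    (fun r hr hrn => Nat.minFac_le_of_dvd hr.two_le (hLK ▸ hrn)) hqu
end

section
/- Let q ≥ 7 be prime. There exists a field extension H of ℚ_2 with [H : ℚ_2] = 2q and an intermediate field K of H/ℚ_2 with [K : ℚ_2] = q, such that every intermediate field of H/ℚ_2 is equal to ℚ_2, to K, or to H (so K is the unique proper nontrivial intermediate field). -/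
open Polynomial Module

lemma two_prime_Z2 : Prime (2 : ℤ_[2]) := by
  simpa using PadicInt.prime_p (p := 2)

lemma eis_Z2 {q : ℕ} (hq : 2 ≤ q) :
    (X ^ q - C 2 : ℤ_[2][X]).IsEisensteinAt (Ideal.span {2}) := by
  have hm : (X ^ q - C 2 : ℤ_[2][X]).Monic := monic_X_pow_sub_C _ (by omega)
  have hp : (Ideal.span {(2 : ℤ_[2])}).IsPrime :=
    (Ideal.span_singleton_prime two_prime_Z2.ne_zero).2 two_prime_Z2
  refine hm.isEisensteinAt_of_mem_of_notMem hp.ne_top ?_ ?_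
  · intro n hn
    rw [natDegree_X_pow_sub_C] at hn
    rw [coeff_sub, coeff_X_pow, if_neg hn.ne, coeff_C, zero_sub]
    split_ifs
    · exact neg_mem (Ideal.mem_span_singleton_self _)
    · simp
  · rw [coeff_sub, coeff_X_pow, if_neg (by omega), coeff_C, if_pos rfl, zero_sub, neg_mem_iff,
      Ideal.span_singleton_pow, Ideal.mem_span_singleton]
    rintro ⟨c, hc⟩
    apply two_prime_Z2.not_isUnit
    have h2 : (2 : ℤ_[2]) * 1 = 2 * (2 * c) := by linear_combination hc
    have := mul_left_cancel₀ two_prime_Z2.ne_zero h2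
    exact IsUnit.of_mul_eq_one c this.symm

lemma map_eis (q : ℕ) : (X ^ q - C 2 : ℤ_[2][X]).map (algebraMap ℤ_[2] ℚ_[2]) = X ^ q - C 2 := by
  simp [map_ofNat (algebraMap ℤ_[2] ℚ_[2]) 2]

lemma irr_Q2 {q : ℕ} (hq : 2 ≤ q) : Irreducible (X ^ q - C 2 : ℚ_[2][X]) := by
  have hm : (X ^ q - C 2 : ℤ_[2][X]).Monic := monic_X_pow_sub_C _ (by omega)
  have hp : (Ideal.span {(2 : ℤ_[2])}).IsPrime :=
    (Ideal.span_singleton_prime two_prime_Z2.ne_zero).2 two_prime_Z2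
  have h := (eis_Z2 hq).irreducible hp hm.isPrimitive (by rw [natDegree_X_pow_sub_C]; omega)
  rw [hm.irreducible_iff_irreducible_map_fraction_map (K := ℚ_[2]), map_eis] at h
  exact h

section
variable {L : Type*} [Field L] [Algebra ℚ_[2] L] (B : PowerBasis ℚ_[2] L)

lemma norm_one_add {q : ℕ} (hq : Odd q) (hB : minpoly ℚ_[2] B.gen = X ^ q - C 2) :
    Algebra.norm ℚ_[2] (1 + B.gen) = 3 := by
  have h1 := Matrix.eval_charpoly (Algebra.leftMulMatrix B.basis B.gen) (-1)
  rw [charpoly_leftMulMatrix, hB] at h1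
  have h2 : Matrix.scalar (Fin B.dim) (-1 : ℚ_[2]) - Algebra.leftMulMatrix B.basis B.gen
      = Algebra.leftMulMatrix B.basis (-(1 + B.gen)) := by
    rw [map_neg, map_one, map_neg, map_add, map_one]
    abel
  have hd : B.dim = q := by
    rw [← B.natDegree_minpoly, hB, natDegree_X_pow_sub_C]
  rw [h2, map_neg, Matrix.det_neg, Fintype.card_fin, show (-1 : ℚ_[2]) ^ B.dim = -1 by rw [hd, hq.neg_one_pow],
    ← Algebra.norm_eq_matrix_det] at h1
  simp [hq.neg_one_pow] at h1
  linear_combination h1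

lemma not_sq [Algebra ℤ_[2] L] [IsScalarTower ℤ_[2] ℚ_[2] L] {q : ℕ} (hq : 2 ≤ q)
    (hB : minpoly ℚ_[2] B.gen = X ^ q - C 2) (c : ℤ_[2]ˣ) (y : L) :
    algebraMap ℤ_[2] L c * y ^ 2 ≠ 1 + B.gen := by
  intro h
  have hroot : B.gen ^ q = 2 := by
    have := minpoly.aeval ℚ_[2] B.gen
    rw [hB] at this
    simpa [sub_eq_zero, map_ofNat (algebraMap ℚ_[2] L) 2] using this
  have hm : (X ^ q - C 2 : ℤ_[2][X]).Monic := monic_X_pow_sub_C _ (by omega)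
  have hint : IsIntegral ℤ_[2] B.gen := ⟨X ^ q - C 2, hm, by simp [hroot, map_ofNat (algebraMap ℤ_[2] L) 2]⟩
  have hmin : minpoly ℤ_[2] B.gen = X ^ q - C 2 := by
    apply map_injective (algebraMap ℤ_[2] ℚ_[2]) (IsFractionRing.injective _ _)
    rw [← minpoly.isIntegrallyClosed_eq_field_fractions' ℚ_[2] hint, map_eis, hB]
  have hyint : IsIntegral ℤ_[2] y := by
    apply IsIntegral.of_pow (n := 2) (by norm_num)
    have : y ^ 2 = ((c⁻¹ : ℤ_[2]ˣ) : ℤ_[2]) • (1 + B.gen) := by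
      rw [← h, ← Algebra.smul_def, smul_smul]; simp
    rw [this]
    exact (isIntegral_one.add hint).smul _
  -- clear denominators
  have hz : ∃ n : ℕ, (2 : ℤ_[2]) ^ n • y ∈ Algebra.adjoin ℤ_[2] ({B.gen} : Set L) := by
    obtain ⟨f, hf⟩ := B.exists_eq_aeval' y
    obtain ⟨b, hbm, hb⟩ := IsLocalization.integerNormalization_spec (nonZeroDivisors ℤ_[2]) f
    have hb0 : (b : ℤ_[2]) ≠ 0 := nonZeroDivisors.ne_zero hbm
    have hbs := PadicInt.unitCoeff_spec hb0
    refine ⟨(b : ℤ_[2]).valuation, ?_⟩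
    have h1 : (b : ℤ_[2]) • y = aeval B.gen
        (IsLocalization.integerNormalization (nonZeroDivisors ℤ_[2]) f) := by
      rw [← aeval_map_algebraMap ℚ_[2], hb, hf, Algebra.smul_def,
        IsScalarTower.algebraMap_apply ℤ_[2] ℚ_[2] L, ← Algebra.smul_def, ← map_smul, algebraMap_smul]
    have h2 : (2 : ℤ_[2]) ^ (b : ℤ_[2]).valuation • y =
        (((PadicInt.unitCoeff hb0)⁻¹ : ℤ_[2]ˣ) : ℤ_[2]) • ((b : ℤ_[2]) • y) := by
      rw [smul_smul]
      congr 1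
      rw [Units.eq_inv_mul_iff_mul_eq]
      exact hbs.symm
    rw [h2, h1]
    exact Subalgebra.smul_mem _ (aeval_mem_adjoin_singleton _ _) _
  obtain ⟨n, hn⟩ := hz
  have hy := mem_adjoin_of_smul_prime_pow_smul_of_minpoly_isEisensteinAt two_prime_Z2 hint hyint hn
    (hmin ▸ eis_Z2 hq)
  rw [Algebra.adjoin_singleton_eq_range_aeval] at hy
  obtain ⟨P, rfl⟩ := hy
  have h0 : aeval B.gen (C (c : ℤ_[2]) * P ^ 2 - 1 - X) = 0 := by
    simp only [map_sub, map_mul, aeval_C, map_pow, aeval_X, map_one]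
    rw [← sub_eq_zero] at h
    rw [← h]
    simp
    ring
  have : FaithfulSMul ℤ_[2] L := (faithfulSMul_iff_algebraMap_injective _ _).2 (by
    rw [IsScalarTower.algebraMap_eq ℤ_[2] ℚ_[2] L]
    exact (algebraMap ℚ_[2] L).injective.comp (IsFractionRing.injective ℤ_[2] ℚ_[2]))
  obtain ⟨g, hg⟩ := minpoly.isIntegrallyClosed_dvd hint h0
  rw [hmin] at hg
  have hd := congrArg (fun f => eval 0 (derivative f)) hg
  simp [derivative_pow, show q ≠ 0 by omega, show q - 1 ≠ 0 by omega] at hd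
  apply two_prime_Z2.not_isUnit
  refine IsUnit.of_mul_eq_one (↑c * (eval 0 P * eval 0 (derivative P)) + eval 0 (derivative g)) ?_
  linear_combination hd
end


/-- no quadratic subfield implies uniqueness -/
lemma unique_of_no_quad {k H : Type*} [Field k] [CharZero k] [Field H] [Algebra k H] {q : ℕ}
    (hq : q.Prime) (hq2 : q ≠ 2) (hH : finrank k H = 2 * q)
    (K : IntermediateField k H) (hK : finrank k K = q)
    (hno : ∀ M : IntermediateField k H, finrank k M ≠ 2) (M : IntermediateField k H) :
    M = ⊥ ∨ M = K ∨ M = ⊤ := by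
  have hq0 := hq.pos
  have : FiniteDimensional k H := FiniteDimensional.of_finrank_pos (by omega)
  have hdvd : finrank k M ∣ 2 * q := by
    rw [← hH]; exact ⟨_, (finrank_mul_finrank k M H).symm⟩
  have hquad : ∀ N : IntermediateField k H, finrank k N = q → IsGalois N H := by
    intro N hN
    have h2 : finrank N H = 2 := by
      have := finrank_mul_finrank k N H
      rw [hN, hH, mul_comm 2 q] at this
      exact Nat.eq_of_mul_eq_mul_left hq0 this
    have : Algebra.IsQuadraticExtension N H := { finrank_eq_two' := h2 }
    infer_instance
  rcases (Nat.dvd_mul).1 hdvd with ⟨a, b, ha, hb, hab⟩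
  rcases (Nat.dvd_prime Nat.prime_two).1 ha with rfl | rfl <;>
    rcases (Nat.dvd_prime hq).1 hb with rfl | rfl
  · left
    exact IntermediateField.finrank_eq_one_iff.1 (by omega)
  · right; left
    by_contra hne
    have hM : finrank k M = b := by omega
    have hinf : M ⊓ K = ⊥ := by
      rw [← IntermediateField.finrank_eq_one_iff]
      have h1 : finrank k (M ⊓ K : IntermediateField k H) ∣ b := by
        rw [← hK]; exact IntermediateField.finrank_dvd_of_le_right inf_le_right
      rcases (Nat.dvd_prime hq).1 h1 with h | h
      · exact h
      · exfalso
        apply hne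
        have e1 := IntermediateField.eq_of_le_of_finrank_eq (inf_le_right : M ⊓ K ≤ K)
          (h.trans hK.symm)
        have e2 := IntermediateField.eq_of_le_of_finrank_eq (inf_le_left : M ⊓ K ≤ M)
          (h.trans hM.symm)
        exact e2.symm.trans e1
    have hmem : ∀ N : IntermediateField k H, finrank k N = b →
        IntermediateField.fixedField (⊤ : Subgroup (H ≃ₐ[k] H)) ≤ N := by
      intro N hN
      have := hquad N hN
      intro x hx
      have hb : x ∈ (⊥ : IntermediateField N H) := by
        rw [IsGalois.mem_bot_iff_fixed]
        intro σ
        exact (IntermediateField.mem_fixedField_iff _ _).1 hx (σ.restrictScalars k) trivial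
      obtain ⟨y, rfl⟩ := IntermediateField.mem_bot.1 hb
      exact y.2
    have hgal : IsGalois k H := by
      apply IsGalois.of_fixedField_eq_bot
      rw [eq_bot_iff, ← hinf]
      exact le_inf (hmem M hM) (hmem K hK)
    have : Fact b.Prime := ⟨hq⟩
    have hcard : Nat.card (H ≃ₐ[k] H) = 2 * b := by
      rw [IsGalois.card_aut_eq_finrank, hH]
    obtain ⟨g, hg⟩ := exists_prime_orderOf_dvd_card' (G := H ≃ₐ[k] H) b (by rw [hcard]; simp)
    apply hno (IntermediateField.fixedField (Subgroup.zpowers g))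
    have h3 := IntermediateField.finrank_fixedField_eq_card (Subgroup.zpowers g)
    rw [Nat.card_zpowers, hg] at h3
    have h4 := finrank_mul_finrank k (IntermediateField.fixedField (Subgroup.zpowers g)) H
    rw [h3, hH] at h4
    exact Nat.eq_of_mul_eq_mul_right hq0 h4
  · exact absurd (by omega) (hno M)
  · right; right
    exact IntermediateField.eq_of_le_of_finrank_eq le_top
      (by rw [IntermediateField.finrank_top', hH]; omega)

/-- a quadratic subfield has a square root generator -/
lemma exists_sqrt {k F : Type*} [Field k] [CharZero k] [Field F] [Algebra k F]
    (hF : finrank k F = 2) :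
    ∃ (x : F) (d : k), x ^ 2 = algebraMap k F d ∧ x ∉ (algebraMap k F).range := by
  have : FiniteDimensional k F := FiniteDimensional.of_finrank_pos (by omega)
  have : ∃ x : F, x ∉ (algebraMap k F).range := by
    by_contra! h
    have : (⊥ : Subalgebra k F) = ⊤ := by
      rw [eq_top_iff]; intro x _; exact h x
    have h1 := Subalgebra.bot_eq_top_iff_finrank_eq_one.1 this
    omega
  obtain ⟨x, hx⟩ := this
  have hi : IsIntegral k x := IsIntegral.of_finite k x
  have hdeg : (minpoly k x).natDegree = 2 := by
    have h1 : (minpoly k x).natDegree ∣ 2 := hF ▸ minpoly.degree_dvd hi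
    rcases (Nat.dvd_prime Nat.prime_two).1 h1 with h | h
    · exact absurd (minpoly.natDegree_eq_one_iff.1 h) hx
    · exact h
  have hm := minpoly.monic hi
  have h0 := minpoly.aeval k x
  rw [aeval_eq_sum_range, hdeg] at h0
  have hl : (minpoly k x).coeff 2 = 1 := hdeg ▸ hm.coeff_natDegree
  simp [Finset.sum_range_succ, hl, Algebra.smul_def] at h0
  set b := (minpoly k x).coeff 1
  set c := (minpoly k x).coeff 0
  have : CharZero F := charZero_of_injective_algebraMap (algebraMap k F).injective
  refine ⟨x + algebraMap k F (b / 2), b ^ 2 / 4 - c, ?_, ?_⟩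
  · simp only [map_sub, map_div₀, map_pow, map_ofNat (algebraMap k F) 2, map_ofNat (algebraMap k F) 4]
    field_simp
    linear_combination 16 * h0
  · intro h
    apply hx
    have := Subring.sub_mem _ h ⟨b / 2, rfl⟩
    simpa using this

lemma no_quad {L H : Type*} [Field L] [Field H] [Algebra ℚ_[2] L] [Algebra L H] [Algebra ℚ_[2] H]
    [IsScalarTower ℚ_[2] L H] {q : ℕ} (hqo : Odd q) (hL : finrank ℚ_[2] L = q)
    (u : L) (α : H) (hα : α ^ 2 = algebraMap L H u)
    (hspan : ∀ x : H, ∃ a b : L, x = algebraMap L H a + algebraMap L H b * α)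
    (hN : Algebra.norm ℚ_[2] u = 3) (h1 : ∀ y : L, y ^ 2 ≠ u) (h3 : ∀ y : L, 3 * y ^ 2 ≠ u)
    (M : IntermediateField ℚ_[2] H) : finrank ℚ_[2] M ≠ 2 := by
  intro hM
  have : CharZero L := charZero_of_injective_algebraMap (algebraMap ℚ_[2] L).injective
  obtain ⟨x', d, hx'd, hx'⟩ := exists_sqrt hM
  obtain ⟨x, hx⟩ : ∃ x : H, x = x' := ⟨_, rfl⟩
  have hxd : x ^ 2 = algebraMap L H (algebraMap ℚ_[2] L d) := by
    rw [← IsScalarTower.algebraMap_apply, hx]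
    exact congrArg Subtype.val hx'd
  have hxr : ∀ r : ℚ_[2], x ≠ algebraMap L H (algebraMap ℚ_[2] L r) := by
    intro r hr
    apply hx'
    refine ⟨r, Subtype.ext ?_⟩
    rw [← hx, hr, ← IsScalarTower.algebraMap_apply]
    rfl
  have hd0 : d ≠ 0 := by
    rintro rfl
    apply hxr 0
    simpa using hxd
  obtain ⟨m, hm⟩ := hqo
  have hinj := (algebraMap L H).injective
  have hinj2 := (algebraMap ℚ_[2] L).injective
  obtain ⟨a, b, hab⟩ := hspan x
  have hsq : algebraMap L H (a ^ 2 + b ^ 2 * u - algebraMap ℚ_[2] L d)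
      + algebraMap L H (2 * a * b) * α = 0 := by
    simp only [map_add, map_sub, map_mul, map_pow, ← hα, ← hxd, map_ofNat (algebraMap L H) 2]
    rw [hab]; ring
  have hab0 : 2 * a * b = 0 := by
    by_contra hne
    apply h1 (-(a ^ 2 + b ^ 2 * u - algebraMap ℚ_[2] L d) / (2 * a * b))
    apply hinj
    have hne' : algebraMap L H (2 * a * b) ≠ 0 := by simpa using hne
    rw [← hα, map_pow, map_div₀, map_neg]
    congr 1
    rw [div_eq_iff hne']
    linear_combination -hsq
  rw [hab0, map_zero, zero_mul, add_zero, map_eq_zero_iff _ hinj] at hsq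
  have hb0 : b ≠ 0 := by
    rintro rfl
    have ha : a ^ 2 = algebraMap ℚ_[2] L d := by linear_combination hsq
    have hn := congrArg (Algebra.norm ℚ_[2]) ha
    rw [map_pow, Algebra.norm_algebraMap, hL, hm] at hn
    set n := Algebra.norm ℚ_[2] a
    have hs : d = (n / d ^ m) ^ 2 := by
      field_simp
      linear_combination -hn
    rw [hs, map_pow, sq_eq_sq_iff_eq_or_eq_neg, ← map_neg] at ha
    rcases ha with ha | ha <;> exact hxr _ (by rw [hab, map_zero, zero_mul, add_zero, ha])
  have ha0 : a = 0 := by simpa [hb0] using hab0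
  subst ha0
  have hb : b ^ 2 * u = algebraMap ℚ_[2] L d := by linear_combination hsq
  have hn := congrArg (Algebra.norm ℚ_[2]) hb
  rw [map_mul, map_pow, Algebra.norm_algebraMap, hL, hm, hN] at hn
  set n := Algebra.norm ℚ_[2] b
  have hs : d = 3 * (n / d ^ m) ^ 2 := by
    field_simp
    linear_combination -hn
  apply h3 (algebraMap ℚ_[2] L (n / d ^ m) / b)
  rw [hs, map_mul, map_pow, map_ofNat (algebraMap ℚ_[2] L) 3] at hb
  field_simp
  linear_combination -hb

theorem exists_extension_unique_intermediate (q : ℕ) (hq : q.Prime) (hq7 : 7 ≤ q) :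
    ∃ (H : Type) (_ : Field H) (_ : Algebra ℚ_[2] H),
      Module.finrank ℚ_[2] H = 2 * q ∧
      ∃ K : IntermediateField ℚ_[2] H,
        Module.finrank ℚ_[2] K = q ∧
        ∀ M : IntermediateField ℚ_[2] H, M = ⊥ ∨ M = K ∨ M = ⊤ := by
  have hqo : Odd q := hq.odd_of_ne_two (by omega)
  have hirr := irr_Q2 (q := q) (by omega)
  have : Fact (Irreducible (X ^ q - C 2 : ℚ_[2][X])) := ⟨hirr⟩
  have hmon : (X ^ q - C 2 : ℚ_[2][X]).Monic := monic_X_pow_sub_C _ (by omega)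
  let L := AdjoinRoot (X ^ q - C 2 : ℚ_[2][X])
  let B : PowerBasis ℚ_[2] L := AdjoinRoot.powerBasis hirr.ne_zero
  have hB : minpoly ℚ_[2] B.gen = X ^ q - C 2 :=
    AdjoinRoot.minpoly_powerBasis_gen_of_monic hmon
  have hL : finrank ℚ_[2] L = q := by
    rw [B.finrank, ← B.natDegree_minpoly, hB, natDegree_X_pow_sub_C]
  have hN := norm_one_add B hqo hB
  have h1 : ∀ y : L, y ^ 2 ≠ 1 + B.gen := by
    intro y hy
    exact not_sq B (by omega) hB 1 y (by simpa using hy)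
  have h3 : ∀ y : L, 3 * y ^ 2 ≠ 1 + B.gen := by
    intro y hy
    have hu : IsUnit (3 : ℤ_[2]) := by
      rw [PadicInt.isUnit_iff]
      have := (PadicInt.norm_natCast_eq_one_iff (p := 2) (n := 3)).2 (by norm_num)
      simpa using this
    refine not_sq B (by omega) hB hu.unit y ?_
    rw [IsUnit.unit_spec, map_ofNat (algebraMap ℤ_[2] L) 3]
    exact hy
  have hirr2 : Irreducible (X ^ 2 - C (1 + B.gen) : L[X]) :=
    X_pow_sub_C_irreducible_of_prime Nat.prime_two h1
  have : Fact (Irreducible (X ^ 2 - C (1 + B.gen) : L[X])) := ⟨hirr2⟩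
  let H := AdjoinRoot (X ^ 2 - C (1 + B.gen) : L[X])
  let B2 : PowerBasis L H := AdjoinRoot.powerBasis hirr2.ne_zero
  have hB2 : B2.dim = 2 := by
    have : B2.dim = (X ^ 2 - C (1 + B.gen) : L[X]).natDegree := AdjoinRoot.powerBasis_dim hirr2.ne_zero
    rw [this, natDegree_X_pow_sub_C]
  have hLH : finrank L H = 2 := by rw [B2.finrank, hB2]
  have : Module.Finite ℚ_[2] L := B.finite
  have hH : finrank ℚ_[2] H = 2 * q := by
    rw [← finrank_mul_finrank ℚ_[2] L H, hL, hLH, mul_comm]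
  refine ⟨H, inferInstance, inferInstance, hH, (IsScalarTower.toAlgHom ℚ_[2] L H).fieldRange, ?_, ?_⟩
  · refine Eq.trans ?_ hL
    exact (AlgEquiv.ofInjectiveField (IsScalarTower.toAlgHom ℚ_[2] L H)).toLinearEquiv.finrank_eq.symm
  refine unique_of_no_quad hq (by omega) hH _ ?_ ?_
  · refine Eq.trans ?_ hL
    exact (AlgEquiv.ofInjectiveField (IsScalarTower.toAlgHom ℚ_[2] L H)).toLinearEquiv.finrank_eq.symm
  refine no_quad hqo hL (1 + B.gen) (AdjoinRoot.root (X ^ 2 - C (1 + B.gen) : L[X]) : H) ?_ ?_ hN h1 h3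
  · have := AdjoinRoot.eval₂_root (X ^ 2 - C (1 + B.gen) : L[X])
    rw [eval₂_sub, eval₂_X_pow, eval₂_C, sub_eq_zero] at this
    exact this
  · intro x
    obtain ⟨f, hf, hx⟩ := B2.exists_eq_aeval x
    rw [hB2] at hf
    refine ⟨f.coeff 0, f.coeff 1, ?_⟩
    rw [hx, aeval_eq_sum_range' hf, Finset.sum_range_succ, Finset.sum_range_one]
    simp only [Algebra.smul_def, pow_zero, pow_one, mul_one]
    rfl
end
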